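/- arXiv:1705.03083 — 2 statements merged into one kernel-verified Lean document; each statement's English description precedes it below -/
import Mathlib

section
/- The center Z(U) of the restricted quantum group U has ℂ-dimension 3p − 1. -/
open scoped TensorProduct
open Finset

noncomputable section

namespace LogHennings

/-- `q = exp(iπ/p)`. -/
def qq (p : ℕ) : ℂ := Complex.exp ((Real.pi : ℂ) * Complex.I / (p : ℂ))

/-- `q^{1/2} = exp(iπ/(2p))`. -/
def qh (p : ℕ) : ℂ := Complex.exp ((Real.pi : ℂ) * Complex.I / (2 * (p : ℂ)))

/-- quantum integer `[m] = (q^m - q^{-m})/(q - q⁻¹)`. -/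
def qnum (p m : ℕ) : ℂ := ((qq p) ^ m - (qq p)⁻¹ ^ m) / (qq p - (qq p)⁻¹)

/-- quantum factorial `[m]! = [m][m-1]⋯[1]`. -/
def qfac (p : ℕ) : ℕ → ℂ
  | 0 => 1
  | m + 1 => qnum p (m + 1) * qfac p m

/-- Generators of the restricted quantum group `U`. -/
inductive UGen | E | F | K | Kinv

abbrev FU := FreeAlgebra ℂ UGen

def fE : FU := FreeAlgebra.ι ℂ UGen.E
def fF : FU := FreeAlgebra.ι ℂ UGen.F
def fK : FU := FreeAlgebra.ι ℂ UGen.K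
def fKinv : FU := FreeAlgebra.ι ℂ UGen.Kinv

/-- Defining relations of the restricted quantum group `U`. -/
inductive URel (p : ℕ) : FU → FU → Prop
  | Epow : URel p (fE ^ p) 0
  | Fpow : URel p (fF ^ p) 0
  | Kpow : URel p (fK ^ (2 * p)) 1
  | KKinv : URel p (fK * fKinv) 1
  | KinvK : URel p (fKinv * fK) 1
  | KE : URel p (fK * fE * fKinv) ((qq p) ^ 2 • fE)
  | KF : URel p (fK * fF * fKinv) (((qq p) ^ 2)⁻¹ • fF)
  | EF : URel p (fE * fF - fF * fE) ((qq p - (qq p)⁻¹)⁻¹ • (fK - fKinv))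

/-- The restricted quantum group `U = \bar U_q(sl2)`. -/
abbrev Uq (p : ℕ) := RingQuot (URel p)

def UE (p : ℕ) : Uq p := RingQuot.mkAlgHom ℂ (URel p) fE
def UF (p : ℕ) : Uq p := RingQuot.mkAlgHom ℂ (URel p) fF
def UK (p : ℕ) : Uq p := RingQuot.mkAlgHom ℂ (URel p) fK
def UKinv (p : ℕ) : Uq p := RingQuot.mkAlgHom ℂ (URel p) fKinv

/-- Generators of the braided extension `D`. -/
inductive DGen | e | phi | k | kinv

abbrev FD := FreeAlgebra ℂ DGen

def fe : FD := FreeAlgebra.ι ℂ DGen.e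
def fphi : FD := FreeAlgebra.ι ℂ DGen.phi
def fk : FD := FreeAlgebra.ι ℂ DGen.k
def fkinv : FD := FreeAlgebra.ι ℂ DGen.kinv

/-- Defining relations of `D`. -/
inductive DRel (p : ℕ) : FD → FD → Prop
  | epow : DRel p (fe ^ p) 0
  | phipow : DRel p (fphi ^ p) 0
  | kpow : DRel p (fk ^ (4 * p)) 1
  | kkinv : DRel p (fk * fkinv) 1
  | kinvk : DRel p (fkinv * fk) 1
  | ke : DRel p (fk * fe * fkinv) (qq p • fe)
  | kphi : DRel p (fk * fphi * fkinv) ((qq p)⁻¹ • fphi)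
  | ephi : DRel p (fe * fphi - fphi * fe)
      ((qq p - (qq p)⁻¹)⁻¹ • (fk ^ 2 - fkinv ^ 2))

/-- The braided extension `D` of `U`. -/
abbrev Dq (p : ℕ) := RingQuot (DRel p)

def De (p : ℕ) : Dq p := RingQuot.mkAlgHom ℂ (DRel p) fe
def Dphi (p : ℕ) : Dq p := RingQuot.mkAlgHom ℂ (DRel p) fphi
def Dk (p : ℕ) : Dq p := RingQuot.mkAlgHom ℂ (DRel p) fk
def Dkinv (p : ℕ) : Dq p := RingQuot.mkAlgHom ℂ (DRel p) fkinv

/-- The `R`-matrix of `D`. -/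
def Rmat (p : ℕ) : Dq p ⊗[ℂ] Dq p :=
  ((4 * (p : ℂ))⁻¹) •
    ∑ m ∈ range p, ∑ n ∈ range (4 * p), ∑ j ∈ range (4 * p),
      (((qq p - (qq p)⁻¹) ^ m / qfac p m) *
          (qh p) ^ ((m : ℤ) * ((m : ℤ) - 1) + 2 * (m : ℤ) * ((n : ℤ) - (j : ℤ))
            - (n : ℤ) * (j : ℤ))) •
        ((De p ^ m * Dk p ^ n) ⊗ₜ[ℂ] (Dphi p ^ m * Dk p ^ j))

/-- `R₂₁ = τ(R)`. -/
def R21 (p : ℕ) : Dq p ⊗[ℂ] Dq p := TensorProduct.comm ℂ (Dq p) (Dq p) (Rmat p)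

/-- The monodromy `M = R₂₁ R`. -/
def Mmat (p : ℕ) : Dq p ⊗[ℂ] Dq p := R21 p * Rmat p

/-- The ribbon element `r ∈ D`. -/
def rib (p : ℕ) : Dq p :=
  ((1 - Complex.I) / (2 * (Real.sqrt p : ℂ))) •
    ∑ m ∈ range p, ∑ j ∈ range (2 * p),
      (((qq p - (qq p)⁻¹) ^ m / qfac p m) *
          (qh p) ^ (-(m : ℤ) + 2 * (m : ℤ) * (j : ℤ) + ((j : ℤ) + (p : ℤ) + 1) ^ 2)) •
        (Dphi p ^ m * De p ^ m * Dk p ^ (2 * j))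

/-- The Drinfeld element `u = Σ S(β_i) α_i` for `R = Σ α_i ⊗ β_i`,
depending on a choice of antipode `S`. -/
def drinfeldU (p : ℕ) (S : Dq p →ₗ[ℂ] Dq p) : Dq p :=
  LinearMap.mul' ℂ (Dq p) (TensorProduct.map S LinearMap.id (R21 p))

/-- `Δ` takes the prescribed values on the generators of `U`. -/
def IsDeltaU (p : ℕ) (Δ : Uq p →ₐ[ℂ] Uq p ⊗[ℂ] Uq p) : Prop :=
  Δ (UE p) = 1 ⊗ₜ[ℂ] UE p + UE p ⊗ₜ[ℂ] UK p ∧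
  Δ (UF p) = UKinv p ⊗ₜ[ℂ] UF p + UF p ⊗ₜ[ℂ] 1 ∧
  Δ (UK p) = UK p ⊗ₜ[ℂ] UK p ∧
  Δ (UKinv p) = UKinv p ⊗ₜ[ℂ] UKinv p

/-- `ε` takes the prescribed values on the generators of `U`. -/
def IsCounitU (p : ℕ) (ε : Uq p →ₐ[ℂ] ℂ) : Prop :=
  ε (UE p) = 0 ∧ ε (UF p) = 0 ∧ ε (UK p) = 1 ∧ ε (UKinv p) = 1

/-- `S` is an algebra anti-homomorphism taking the prescribed values on the
generators of `U`. -/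
def IsAntipodeU (p : ℕ) (S : Uq p →ₗ[ℂ] Uq p) : Prop :=
  S 1 = 1 ∧ (∀ x y, S (x * y) = S y * S x) ∧
  S (UE p) = -(UE p * UKinv p) ∧ S (UF p) = -(UK p * UF p) ∧
  S (UK p) = UKinv p ∧ S (UKinv p) = UK p

/-- `Δ` takes the prescribed values on the generators of `D`. -/
def IsDeltaD (p : ℕ) (Δ : Dq p →ₐ[ℂ] Dq p ⊗[ℂ] Dq p) : Prop :=
  Δ (De p) = 1 ⊗ₜ[ℂ] De p + De p ⊗ₜ[ℂ] (Dk p ^ 2) ∧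
  Δ (Dphi p) = (Dkinv p ^ 2) ⊗ₜ[ℂ] Dphi p + Dphi p ⊗ₜ[ℂ] 1 ∧
  Δ (Dk p) = Dk p ⊗ₜ[ℂ] Dk p ∧
  Δ (Dkinv p) = Dkinv p ⊗ₜ[ℂ] Dkinv p

/-- `ε` takes the prescribed values on the generators of `D`. -/
def IsCounitD (p : ℕ) (ε : Dq p →ₐ[ℂ] ℂ) : Prop :=
  ε (De p) = 0 ∧ ε (Dphi p) = 0 ∧ ε (Dk p) = 1 ∧ ε (Dkinv p) = 1

/-- `S` is an algebra anti-homomorphism taking the prescribed values on the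
generators of `D`. -/
def IsAntipodeD (p : ℕ) (S : Dq p →ₗ[ℂ] Dq p) : Prop :=
  S 1 = 1 ∧ (∀ x y, S (x * y) = S y * S x) ∧
  S (De p) = -(De p * Dkinv p ^ 2) ∧ S (Dphi p) = -(Dk p ^ 2 * Dphi p) ∧
  S (Dk p) = Dkinv p ∧ S (Dkinv p) = Dk p

/-- `ι` takes the prescribed values `E ↦ e`, `F ↦ φ`, `K^{±1} ↦ k^{±2}`. -/
def IsIota (p : ℕ) (ι : Uq p →ₐ[ℂ] Dq p) : Prop :=
  ι (UE p) = De p ∧ ι (UF p) = Dphi p ∧ ι (UK p) = Dk p ^ 2 ∧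
  ι (UKinv p) = Dkinv p ^ 2

/-- `μ` takes the prescribed values on the PBW basis of `U`. -/
def IsMu (p : ℕ) (μ : Uq p →ₗ[ℂ] ℂ) : Prop :=
  ∀ m n l : ℕ, m < p → n < p → l < 2 * p →
    μ (UE p ^ m * UF p ^ n * UK p ^ l) =
      if m = p - 1 ∧ n = p - 1 ∧ l = p + 1 then
        -((Real.sqrt (2 / (p : ℝ)) : ℂ)) * (qfac p (p - 1)) ^ 2
      else 0

variable {A : Type*} [Ring A] [Algebra ℂ A]

/-- Coassociativity of a comultiplication. -/
def Coassoc (Δ : A →ₐ[ℂ] A ⊗[ℂ] A) : Prop :=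
  ∀ x, TensorProduct.assoc ℂ A A A
      (TensorProduct.map Δ.toLinearMap LinearMap.id (Δ x)) =
    TensorProduct.map LinearMap.id Δ.toLinearMap (Δ x)

/-- The counit axiom. -/
def CounitAxiom (Δ : A →ₐ[ℂ] A ⊗[ℂ] A) (ε : A →ₐ[ℂ] ℂ) : Prop :=
  (∀ x, TensorProduct.lid ℂ A
      (TensorProduct.map ε.toLinearMap LinearMap.id (Δ x)) = x) ∧
  (∀ x, TensorProduct.rid ℂ A
      (TensorProduct.map LinearMap.id ε.toLinearMap (Δ x)) = x)

/-- The antipode axiom. -/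
def AntipodeAxiom (Δ : A →ₐ[ℂ] A ⊗[ℂ] A) (ε : A →ₐ[ℂ] ℂ)
    (S : A →ₗ[ℂ] A) : Prop :=
  (∀ x, LinearMap.mul' ℂ A (TensorProduct.map S LinearMap.id (Δ x)) = ε x • 1) ∧
  (∀ x, LinearMap.mul' ℂ A (TensorProduct.map LinearMap.id S (Δ x)) = ε x • 1)

/-- `x ↦ x ⊗ 1`. -/
def e1 (p : ℕ) : Dq p →ₗ[ℂ] Dq p ⊗[ℂ] Dq p :=
  (TensorProduct.mk ℂ (Dq p) (Dq p)).flip 1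

/-- `x ↦ 1 ⊗ x`. -/
def e2 (p : ℕ) : Dq p →ₗ[ℂ] Dq p ⊗[ℂ] Dq p :=
  TensorProduct.mk ℂ (Dq p) (Dq p) 1

/-- The balancing element `g = K^{p+1}`. -/
def gU (p : ℕ) : Uq p := UK p ^ (p + 1)

/-- The span of commutators `[U,U]`. -/
def commSpan (p : ℕ) : Submodule ℂ (Uq p) :=
  Submodule.span ℂ {z : Uq p | ∃ x y : Uq p, z = x * y - y * x}

end LogHennings

namespace LH
open Polynomial

/-- Eigenvalues of the Casimir. -/
def cc (q : ℂ) (j : ℤ) : ℂ := ((q - q⁻¹) ^ 2)⁻¹ * (q ^ (j + 1) + q ^ (-(j + 1)))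

def Dp (p : ℕ) (q : ℂ) (j : ℤ) : ℂ[X] :=
  ∏ i ∈ range (p - 1), (X - C (cc q (j + 2 + 2 * (i : ℤ))))

def Psi (p : ℕ) (q : ℂ) (j : ℤ) : ℂ[X] :=
  ∏ i ∈ range p, (X - C (cc q (j + 2 * (i : ℤ))))

lemma prod_window {R : Type*} [CommMonoid R] (p : ℕ) (y : ℤ → R) (hy : ∀ i, y (i + p) = y i)
    (s : ℤ) : ∏ i ∈ range p, y (s + i) = ∏ i ∈ range p, y i := by
  have step : ∀ s : ℤ, ∏ i ∈ range p, y (s + 1 + i) = ∏ i ∈ range p, y (s + i) := by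
    intro s
    rcases p with _ | p
    · simp
    · rw [prod_range_succ, prod_range_succ']
      congr 1
      · apply prod_congr rfl
        intro i _
        congr 1
        push_cast; ring
      · have := hy s
        rw [← add_zero s] at this
        push_cast at this ⊢
        rw [← this]
        congr 1
        ring
  induction s using Int.induction_on with
  | zero => simp
  | succ i ih => rw [step, ih]
  | pred i ih =>
    rw [← ih, ← step]
    simp

lemma per_mul {α : Type*} (p : ℕ) (f : ℤ → α) (hf : ∀ j, f (j + 2 * p) = f j) (j m : ℤ) :
    f (j + (2 * p) * m) = f j := by
  induction m using Int.induction_on with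
  | zero => simp
  | succ i ih => rw [← ih, ← hf (j + 2 * p * i)]; congr 1; ring
  | pred i ih => rw [← ih, ← hf (j + 2 * p * (-(i : ℤ) - 1))]; congr 1; ring

lemma q_ne {p : ℕ} {q : ℂ} (hp : 2 ≤ p) (hq : IsPrimitiveRoot q (2 * p)) : q ≠ 0 := hq.ne_zero (by omega)

lemma qq_ne {p : ℕ} {q : ℂ} (hp : 2 ≤ p) (hq : IsPrimitiveRoot q (2 * p)) : q - q⁻¹ ≠ 0 := by
  have h0 := q_ne hp hq
  intro h
  have h1 : q ^ 2 = 1 := by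
    have : q = q⁻¹ := sub_eq_zero.1 h
    rw [pow_two]; nth_rw 1 [this]; exact inv_mul_cancel₀ h0
  have := (hq.pow_eq_one_iff_dvd 2).1 h1
  have := Nat.le_of_dvd (by norm_num) this
  omega

lemma q_per {p : ℕ} {q : ℂ} (hp : 2 ≤ p) (hq : IsPrimitiveRoot q (2 * p)) (j : ℤ) : q ^ (j + 2 * (p : ℤ)) = q ^ j := by
  rw [zpow_add₀ (q_ne hp hq)]
  have : q ^ (2 * (p : ℤ)) = 1 := by
    have := hq.pow_eq_one
    exact_mod_cast this
  rw [this, mul_one]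

lemma q_zpow_eq {p : ℕ} {q : ℂ} (hp : 2 ≤ p) (hq : IsPrimitiveRoot q (2 * p)) (i j : ℤ) (h : q ^ i = q ^ j) : (2 * p : ℤ) ∣ i - j := by
  have h0 := q_ne hp hq
  have : q ^ (i - j) = 1 := by
    rw [zpow_sub₀ h0, h, div_self (zpow_ne_zero _ h0)]
  have := (hq.zpow_eq_one_iff_dvd _).1 this
  exact_mod_cast this

lemma cc_per {p : ℕ} {q : ℂ} (hp : 2 ≤ p) (hq : IsPrimitiveRoot q (2 * p)) (j : ℤ) : cc q (j + 2 * (p : ℤ)) = cc q j := by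
  unfold cc
  have h1 : q ^ (j + 2 * (p : ℤ) + 1) = q ^ (j + 1) := by
    rw [← q_per hp hq (j + 1)]; congr 1; ring
  have h2 : q ^ (-(j + 1)) = q ^ (-(j + 2 * (p : ℤ) + 1)) := by
    rw [← q_per hp hq (-(j + 2 * (p : ℤ) + 1))]; congr 1; ring
  rw [h1, h2]

lemma cc_refl {q : ℂ} (j : ℤ) : cc q (-2 - j) = cc q j := by
  unfold cc
  rw [show -2 - j + 1 = -(j + 1) by ring, neg_neg, add_comm]

lemma cc_eq {p : ℕ} {q : ℂ} (hp : 2 ≤ p) (hq : IsPrimitiveRoot q (2 * p)) (i j : ℤ) (h : cc q i = cc q j) :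
    (2 * p : ℤ) ∣ i - j ∨ (2 * p : ℤ) ∣ i + j + 2 := by
  have h0 := q_ne hp hq
  have h1 := qq_ne hp hq
  unfold cc at h
  have h2 := mul_left_cancel₀ (inv_ne_zero (pow_ne_zero 2 h1)) h
  have h3 : (q ^ (i + 1) - q ^ (j + 1)) * (q ^ (i + 1) * q ^ (j + 1) - 1) = 0 := by
    have ha := zpow_ne_zero (i + 1) h0
    have hb := zpow_ne_zero (j + 1) h0
    rw [zpow_neg, zpow_neg] at h2
    field_simp at h2
    linear_combination h2
  rcases mul_eq_zero.1 h3 with h4 | h4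
  · left
    have := q_zpow_eq hp hq _ _ (sub_eq_zero.1 h4)
    simpa using this
  · right
    rw [← zpow_add₀ h0, sub_eq_zero] at h4
    have := q_zpow_eq hp hq (i + 1 + (j + 1)) 0 (by simpa using h4)
    convert this using 1
    ring

lemma Psi_eq {p : ℕ} {q : ℂ} (hp : 2 ≤ p) (j : ℤ) : Psi p q j = (X - C (cc q j)) * Dp p q j := by
  unfold Psi Dp
  obtain ⟨n, rfl⟩ : ∃ n, p = n + 1 := ⟨p - 1, by omega⟩
  rw [prod_range_succ', mul_comm]
  simp only [Nat.cast_zero, mul_zero, add_zero, Nat.add_sub_cancel]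
  congr 1
  apply prod_congr rfl
  intro i _
  congr 3
  push_cast; ring

lemma Psi_shift {p : ℕ} {q : ℂ} (hp : 2 ≤ p) (hq : IsPrimitiveRoot q (2 * p)) (j : ℤ) (i : ℤ) : Psi p q (j + 2 * i) = Psi p q j := by
  unfold Psi
  have := prod_window p (fun i : ℤ => (X - C (cc q (j + 2 * i)) : ℂ[X])) (by
    intro i
    rw [← cc_per hp hq (j + 2 * i)]
    congr 3
    ring) i
  rw [← this]
  apply prod_congr rfl
  intro k _
  congr 3
  ring

lemma Psi_monic {p : ℕ} {q : ℂ} (j : ℤ) : (Psi p q j).Monic :=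
  monic_prod_of_monic _ _ fun _ _ => monic_X_sub_C _

lemma Psi_deg {p : ℕ} {q : ℂ} (j : ℤ) : (Psi p q j).degree = p := by
  rw [degree_eq_natDegree (Psi_monic j).ne_zero]
  unfold Psi
  rw [natDegree_prod_of_monic _ _ fun _ _ => monic_X_sub_C _]
  simp

lemma Dp_monic {p : ℕ} {q : ℂ} (j : ℤ) : (Dp p q j).Monic :=
  monic_prod_of_monic _ _ fun _ _ => monic_X_sub_C _

lemma Dp_natDeg {p : ℕ} {q : ℂ} (j : ℤ) : (Dp p q j).natDegree = p - 1 := by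
  unfold Dp
  rw [natDegree_prod_of_monic _ _ fun _ _ => monic_X_sub_C _]
  simp

lemma Dp_per {p : ℕ} {q : ℂ} (hp : 2 ≤ p) (hq : IsPrimitiveRoot q (2 * p)) (j : ℤ) : Dp p q (j + 2 * p) = Dp p q j := by
  unfold Dp
  apply prod_congr rfl
  intro i _
  rw [← cc_per hp hq (j + 2 + 2 * i)]
  congr 3
  ring

lemma Dp_per' {p : ℕ} {q : ℂ} (hp : 2 ≤ p) (hq : IsPrimitiveRoot q (2 * p)) (j m : ℤ) : Dp p q (j + (2 * p) * m) = Dp p q j :=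
  per_mul p (Dp p q) (Dp_per hp hq) j m

lemma Dp_refl {p : ℕ} {q : ℂ} (hp : 2 ≤ p) (hq : IsPrimitiveRoot q (2 * p)) (j : ℤ) : Dp p q (-2 - j) = Dp p q j := by
  unfold Dp
  rw [← prod_range_reflect]
  apply prod_congr rfl
  intro i hi
  rw [mem_range] at hi
  rw [← cc_refl, ← cc_per hp hq (-2 - _)]
  congr 3
  have : ((p - 1 - 1 - i : ℕ) : ℤ) = (p : ℤ) - 1 - 1 - i := by omega
  rw [this]
  ring

lemma Dp_erase {p : ℕ} {q : ℂ} (hp : 2 ≤ p) (hq : IsPrimitiveRoot q (2 * p)) (j : ℤ) (i : ℕ) (hi : i < p) :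
    Dp p q (j + 2 * (i : ℤ)) = ∏ l ∈ (range p).erase i, (X - C (cc q (j + 2 * (l : ℤ)))) := by
  have h1 := Psi_eq (q := q) hp (j + 2 * i)
  rw [Psi_shift hp hq] at h1
  unfold Psi at h1
  rw [← mul_prod_erase (range p) _ (mem_range.2 hi)] at h1
  exact (mul_left_cancel₀ (X_sub_C_ne_zero _) h1).symm

lemma fiber_sum {ι : Type*} [DecidableEq ι] (S : Finset ι) (g : ι → ℂ) (a : ι → ℂ)
    (h : ∑ i ∈ S, C (a i) * ∏ l ∈ S.erase i, (X - C (g l)) = 0) (c : ℂ) :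
    ∑ i ∈ S with g i = c, a i = 0 := by
  classical
  set T := S.filter (fun i => g i = c) with hT
  by_cases hTe : T = ∅
  · rw [hTe]; simp
  obtain ⟨m, hm⟩ : ∃ m, T.card = m + 1 :=
    ⟨T.card - 1, by have := Finset.card_pos.2 (Finset.nonempty_iff_ne_empty.2 hTe); omega⟩
  set G : ℂ[X] := ∏ l ∈ S.filter (fun i => ¬ g i = c), (X - C (g l)) with hG
  have hpow : ∀ T' : Finset ι, T' ⊆ T → ∏ l ∈ T', (X - C (g l)) = (X - C c) ^ T'.card := by
    intro T' hT'
    rw [← prod_const]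
    apply prod_congr rfl
    intro l hl
    have := (mem_filter.1 (hT' hl)).2
    rw [this]
  have hin : ∀ i ∈ T, ∏ l ∈ S.erase i, (X - C (g l)) = (X - C c) ^ m * G := by
    intro i hi
    have : S.erase i = T.erase i ∪ S.filter (fun i => ¬ g i = c) := by
      ext l
      have h2 := (mem_filter.1 hi).2
      simp only [mem_erase, mem_union, mem_filter, hT]
      constructor
      · rintro ⟨h3, h4⟩
        by_cases h5 : g l = c <;> simp [h3, h4, h5]
      · rintro (⟨h3, h4, _⟩ | ⟨h4, h5⟩)
        · exact ⟨h3, h4⟩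
        · exact ⟨fun h => h5 (h ▸ h2), h4⟩
    rw [this, prod_union, hpow _ (erase_subset _ _), card_erase_of_mem hi, hm]
    · simp [hG]
    · rw [Finset.disjoint_left]
      intro l h3 h4
      exact (mem_filter.1 h4).2 (mem_filter.1 (mem_of_mem_erase h3)).2
  have hout : ∀ i ∈ S.filter (fun i => ¬ g i = c), (X - C c) ^ (m + 1) ∣
      C (a i) * ∏ l ∈ S.erase i, (X - C (g l)) := by
    intro i hi
    apply Dvd.dvd.mul_left
    rw [← hm, ← hpow T subset_rfl]
    apply prod_dvd_prod_of_subset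
    intro l hl
    have h1 := mem_filter.1 hl
    refine mem_erase.2 ⟨fun h => ?_, h1.1⟩
    exact (mem_filter.1 hi).2 (h ▸ h1.2)
  rw [← sum_filter_add_sum_filter_not S (fun i => g i = c)] at h
  have h1 : ∑ i ∈ T, C (a i) * ∏ l ∈ S.erase i, (X - C (g l))
      = C (∑ i ∈ T, a i) * ((X - C c) ^ m * G) := by
    rw [map_sum, sum_mul]
    exact sum_congr rfl fun i hi => by rw [hin i hi]
  rw [h1] at h
  have h2 := dvd_sum hout
  have h3 : (X - C c) ^ (m + 1) ∣ C (∑ i ∈ T, a i) * ((X - C c) ^ m * G) := by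
    rw [eq_neg_of_add_eq_zero_left h]
    exact (dvd_neg).2 h2
  have h4 : (X - C c) ∣ C (∑ i ∈ T, a i) * G := by
    rw [pow_succ, mul_left_comm] at h3
    exact (mul_dvd_mul_iff_left (pow_ne_zero _ (X_sub_C_ne_zero c))).1 h3
  rw [dvd_iff_isRoot, IsRoot.def, eval_mul, eval_C, mul_eq_zero] at h4
  rcases h4 with h4 | h4
  · exact h4
  · exfalso
    rw [hG, eval_prod, prod_eq_zero_iff] at h4
    obtain ⟨l, hl, h5⟩ := h4
    rw [eval_sub, eval_X, eval_C, sub_eq_zero] at h5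
    exact (mem_filter.1 hl).2 h5.symm

/-- relation sum implies oddness -/
lemma odd_of_sum {p : ℕ} {q : ℂ} (hp : 2 ≤ p) (hq : IsPrimitiveRoot q (2 * p)) (a : ℤ → ℂ) (ha : ∀ j m : ℤ, a (j + (2 * p) * m) = a j) (k : ℤ)
    (h : ∑ i ∈ range p, C (a (k + 2 * (i : ℤ))) * Dp p q (k + 2 * (i : ℤ)) = 0) :
    a k + a (-2 - k) = 0 := by
  have hp0 : (0 : ℤ) < p := by omega
  have h1 : ∑ i ∈ range p, C (a (k + 2 * (i : ℤ))) *
      ∏ l ∈ (range p).erase i, (X - C (cc q (k + 2 * (l : ℤ)))) = 0 := by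
    rw [← h]
    apply sum_congr rfl
    intro i hi
    rw [Dp_erase hp hq k i (mem_range.1 hi)]
  have h2 := fiber_sum (range p) (fun i : ℕ => cc q (k + 2 * (i : ℤ)))
    (fun i : ℕ => a (k + 2 * (i : ℤ))) h1 (cc q k)
  obtain ⟨i', hi'⟩ : ∃ i' : ℕ, (i' : ℤ) = (-1 - k) % p :=
    ⟨((-1 - k) % p).toNat, Int.toNat_of_nonneg (Int.emod_nonneg _ hp0.ne')⟩
  have hlt : i' < p := by have := Int.emod_lt_of_pos (-1 - k) hp0; omega
  obtain ⟨t, ht⟩ : ∃ t : ℤ, (i' : ℤ) = -1 - k + p * t :=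
    ⟨-((-1 - k) / p), by have := Int.emod_add_mul_ediv (-1 - k) p; rw [hi']; linarith⟩
  have hfib : (range p).filter (fun i : ℕ => cc q (k + 2 * (i : ℤ)) = cc q k) = {0, i'} := by
    ext i
    simp only [mem_filter, mem_range, mem_insert, mem_singleton]
    constructor
    · rintro ⟨h3, h4⟩
      rcases cc_eq hp hq _ _ h4 with ⟨u, hu⟩ | ⟨u, hu⟩
      · left
        have h5 : (i : ℤ) = p * u := by linarith
        have h6 : (i : ℤ) < p := by exact_mod_cast h3
        have : u < 1 := by nlinarith
        have : -1 < u := by nlinarith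
        have : u = 0 := by omega
        subst this; simpa using h5
      · right
        have h5 : (i : ℤ) - i' = p * (u - t) := by linarith
        have h6 : (i : ℤ) < p := by exact_mod_cast h3
        have h7 : (i' : ℤ) < p := by exact_mod_cast hlt
        have : u - t < 1 := by nlinarith
        have : -1 < u - t := by nlinarith
        have : u - t = 0 := by omega
        rw [this] at h5
        omega
    · rintro (rfl | rfl)
      · simp; omega
      · refine ⟨hlt, ?_⟩
        rw [← cc_refl k]
        have : ∀ m : ℤ, cc q (-2 - k + 2 * p * m) = cc q (-2 - k) :=
          fun m => per_mul p (cc q) (cc_per hp hq) _ m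
        rw [← this t, ht]; congr 1; ring
  rw [hfib] at h2
  have hs : a (k + 2 * (i' : ℤ)) = a (-2 - k) := by
    rw [← ha (-2 - k) t, ht]; congr 1; ring
  by_cases h0 : i' = 0
  · rw [h0] at h2 hs
    simp at h2 hs
    rw [← hs, h2]; simp
  · rw [sum_pair (Ne.symm h0), hs] at h2
    simpa using h2

lemma sum_of_odd {p : ℕ} {q : ℂ} (hp : 2 ≤ p) (hq : IsPrimitiveRoot q (2 * p)) (a : ℤ → ℂ) (ha : ∀ j m : ℤ, a (j + (2 * p) * m) = a j)
    (hodd : ∀ j, a j + a (-2 - j) = 0) (k : ℤ) :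
    ∑ i ∈ range p, C (a (k + 2 * (i : ℤ))) * Dp p q (k + 2 * (i : ℤ)) = 0 := by
  have hp0 : (0 : ℤ) < p := by omega
  have key : ∀ i : ℕ, ∃ t : ℤ,
      ((((-1 - k - i) % p).toNat : ℕ) : ℤ) = -1 - k - i + p * t := by
    intro i
    refine ⟨-((-1 - k - i) / p), ?_⟩
    rw [Int.toNat_of_nonneg (Int.emod_nonneg _ hp0.ne')]
    have := Int.emod_add_mul_ediv (-1 - k - i) p; linarith
  have hlt : ∀ i : ℕ, ((-1 - k - i) % p).toNat < p := by
    intro i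
    have := Int.emod_lt_of_pos (-1 - k - i) hp0
    have := Int.emod_nonneg (-1 - k - i) hp0.ne'
    omega
  have hA : ∀ i : ℕ, a (k + 2 * ((((-1 - k - i) % p).toNat : ℕ) : ℤ)) = - a (k + 2 * (i : ℤ)) := by
    intro i
    obtain ⟨t, ht⟩ := key i
    rw [ht, show k + 2 * (-1 - k - i + p * t) = (-2 - (k + 2 * (i : ℤ))) + 2 * p * t by ring, ha]
    linear_combination hodd (k + 2 * (i : ℤ))
  have hD : ∀ i : ℕ, Dp p q (k + 2 * ((((-1 - k - i) % p).toNat : ℕ) : ℤ))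
      = Dp p q (k + 2 * (i : ℤ)) := by
    intro i
    obtain ⟨t, ht⟩ := key i
    rw [ht, show k + 2 * (-1 - k - i + p * t) = (-2 - (k + 2 * (i : ℤ))) + 2 * p * t by ring,
      Dp_per' hp hq, Dp_refl hp hq]
  refine sum_involution (fun i _ => ((-1 - k - (i : ℤ)) % p).toNat) ?_ ?_ ?_ ?_
  · intro i _
    rw [hA, hD, C_neg]; ring
  · intro i _ hne h
    apply hne
    have h1 := hA i
    rw [h] at h1
    have : a (k + 2 * (i : ℤ)) = 0 := by linear_combination h1 / 2
    rw [this]; simp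
  · intro i _
    exact mem_range.2 (hlt i)
  · intro i hi
    obtain ⟨t, ht⟩ := key i
    obtain ⟨t', ht'⟩ := key (((-1 - k - i) % p).toNat)
    have h1 := hlt (((-1 - k - i) % p).toNat)
    have h2 := mem_range.1 hi
    rw [ht] at ht'
    have h5 : ((((-1 - k - (-1 - k - (i : ℤ) + p * t)) % p).toNat : ℕ) : ℤ) - i
        = p * (t' - t) := by linarith
    rw [ht] at h1
    have h6 : (i : ℤ) < p := by exact_mod_cast h2
    have h7 : ((((-1 - k - (-1 - k - (i : ℤ) + p * t)) % p).toNat : ℕ) : ℤ) < p := by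
      exact_mod_cast h1
    have : t' - t < 1 := by nlinarith
    have : -1 < t' - t := by nlinarith
    have : t' - t = 0 := by omega
    rw [this] at h5
    simp only [ht]
    omega
end LH

namespace LH
open Polynomial

/-- The relations of the restricted quantum group, in an arbitrary algebra. -/
structure Rl (p : ℕ) (q : ℂ) {A : Type*} [Ring A] [Algebra ℂ A] (E F K L : A) : Prop where
  hp : 2 ≤ p
  hq : IsPrimitiveRoot q (2 * p)
  Ep : E ^ p = 0
  Fp : F ^ p = 0
  Kp : K ^ (2 * p) = 1
  KL : K * L = 1
  LK : L * K = 1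
  KE : K * E = q ^ 2 • (E * K)
  FK : F * K = q ^ 2 • (K * F)
  EF : E * F - F * E = (q - q⁻¹)⁻¹ • (K - L)

/-- Projectors on the eigenspaces of `K`. -/
def ej (p : ℕ) (q : ℂ) {A : Type*} [Ring A] [Algebra ℂ A] (K : A) (j : ℤ) : A :=
  (2 * p : ℂ)⁻¹ • ∑ k ∈ range (2 * p), (q ^ (-(j * k)) : ℂ) • K ^ k

/-- The Casimir element. -/
def cas (q : ℂ) {A : Type*} [Ring A] [Algebra ℂ A] (E F K L : A) : A :=
  F * E + ((q - q⁻¹) ^ 2)⁻¹ • (q • K + q⁻¹ • L)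

namespace Rl
variable {p : ℕ} {q : ℂ} {A : Type*} [Ring A] [Algebra ℂ A] {E F K L : A}

lemma q0 (h : Rl p q E F K L) : q ≠ 0 := q_ne h.hp h.hq

lemma KEn (h : Rl p q E F K L) (k : ℕ) : E * K ^ k = (q ^ (-(2 * k) : ℤ)) • (K ^ k * E) := by
  have h0 := h.q0
  have h1 : E * K = (q ^ 2)⁻¹ • (K * E) := by
    rw [h.KE, smul_smul, inv_mul_cancel₀ (pow_ne_zero 2 h0), one_smul]
  induction k with
  | zero => simp
  | succ k ih =>
    rw [pow_succ, ← mul_assoc, ih, smul_mul_assoc, mul_assoc, h1, mul_smul_comm, smul_smul,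
      ← mul_assoc]
    congr 1
    rw [show (-(2 * ((k + 1 : ℕ) : ℤ))) = -(2 * (k : ℤ)) + (-2) by push_cast; ring,
      zpow_add₀ h0]
    rfl

lemma KFn (h : Rl p q E F K L) (k : ℕ) : F * K ^ k = (q ^ ((2 * k) : ℤ)) • (K ^ k * F) := by
  have h0 := h.q0
  induction k with
  | zero => simp
  | succ k ih =>
    rw [pow_succ, ← mul_assoc, ih, smul_mul_assoc, mul_assoc, h.FK, mul_smul_comm, smul_smul,
      ← mul_assoc]
    congr 1
    rw [show ((2 * ((k + 1 : ℕ) : ℤ))) = (2 * (k : ℤ)) + 2 by push_cast; ring,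
      zpow_add₀ h0]
    rfl

lemma E_e (h : Rl p q E F K L) (j : ℤ) : E * ej p q K j = ej p q K (j + 2) * E := by
  unfold ej
  rw [mul_smul_comm, smul_mul_assoc, mul_sum, sum_mul]
  congr 1
  apply sum_congr rfl
  intro k _
  rw [mul_smul_comm, h.KEn, smul_smul, smul_mul_assoc, ← zpow_add₀ h.q0]
  congr 2
  ring

lemma F_e (h : Rl p q E F K L) (j : ℤ) : F * ej p q K j = ej p q K (j - 2) * F := by
  unfold ej
  rw [mul_smul_comm, smul_mul_assoc, mul_sum, sum_mul]
  congr 1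
  apply sum_congr rfl
  intro k _
  rw [mul_smul_comm, h.KFn, smul_smul, smul_mul_assoc, ← zpow_add₀ h.q0]
  congr 2
  ring

lemma K_e (h : Rl p q E F K L) (j : ℤ) : K * ej p q K j = q ^ j • ej p q K j := by
  unfold ej
  rw [mul_smul_comm, smul_comm (q ^ j), mul_sum]
  congr 1
  have e1 : ∀ k : ℕ, K * ((q ^ (-(j * k)) : ℂ) • K ^ k)
      = q ^ j • ((q ^ (-(j * ((k + 1 : ℕ) : ℤ))) : ℂ) • K ^ (k + 1)) := by
    intro k
    rw [mul_smul_comm, ← pow_succ', smul_smul, ← zpow_add₀ h.q0]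
    congr 2
    push_cast; ring
  rw [sum_congr rfl fun k _ => e1 k, ← smul_sum]
  congr 1
  have := sum_range_succ (fun k : ℕ => (q ^ (-(j * (k : ℤ))) : ℂ) • K ^ k) (2 * p)
  rw [sum_range_succ'] at this
  have h2 : q ^ (-(j * ((2 * p : ℕ) : ℤ))) = 1 := by
    have := per_mul p (fun i : ℤ => q ^ i) (q_per h.hp h.hq) 0 (-j)
    simp only [zero_add, zpow_zero] at this
    rw [← this]
    congr 1
    push_cast; ring
  rw [h2, h.Kp] at this
  simpa using this

lemma e_comm_K (j : ℤ) : ej p q K j * K = K * ej p q K j := by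
  unfold ej
  rw [smul_mul_assoc, mul_smul_comm, sum_mul, mul_sum]
  congr 1
  apply sum_congr rfl
  intro k _
  rw [smul_mul_assoc, mul_smul_comm, pow_mul_comm']

lemma L_e (h : Rl p q E F K L) (j : ℤ) : L * ej p q K j = q ^ (-j) • ej p q K j := by
  have h1 := congrArg (fun x => q ^ (-j) • (L * x)) (h.K_e j)
  simp only [← mul_assoc, h.LK, one_mul, mul_smul_comm, smul_smul] at h1
  rw [h1, ← zpow_add₀ h.q0]
  simp

lemma Kn_e (h : Rl p q E F K L) (j : ℤ) (n : ℕ) :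
    K ^ n * ej p q K j = q ^ (j * n) • ej p q K j := by
  induction n with
  | zero => simp
  | succ n ih =>
    rw [pow_succ, mul_assoc, h.K_e, mul_smul_comm, ih, smul_smul, ← zpow_add₀ h.q0]
    congr 2
    push_cast; ring

lemma e_per (h : Rl p q E F K L) (j : ℤ) : ej p q K (j + 2 * p) = ej p q K j := by
  unfold ej
  congr 1
  apply sum_congr rfl
  intro k _
  congr 1
  rw [← per_mul p (fun i : ℤ => q ^ i) (q_per h.hp h.hq) (-(j * k)) (-k)]
  congr 1
  ring

lemma e_idem (h : Rl p q E F K L) (j : ℤ) : ej p q K j * ej p q K j = ej p q K j := by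
  have hp := h.hp
  have : ((2 * p : ℕ) : ℂ) ≠ 0 := by
    rw [Nat.cast_ne_zero]; omega
  conv_lhs => lhs; unfold ej
  rw [smul_mul_assoc, sum_mul]
  have e1 : ∀ k ∈ range (2 * p), ((q ^ (-(j * k)) : ℂ) • K ^ k) * ej p q K j = ej p q K j := by
    intro k _
    rw [smul_mul_assoc, h.Kn_e, smul_smul, ← zpow_add₀ h.q0]
    simp
  rw [sum_congr rfl e1, sum_const, card_range, ← Nat.cast_smul_eq_nsmul ℂ, smul_smul]
  push_cast at this ⊢
  rw [inv_mul_cancel₀ this, one_smul]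

lemma e_zero (h : Rl p q E F K L) (i j : ℤ) (hij : ¬ (2 * p : ℤ) ∣ i - j) (x : A)
    (hx : K * x = q ^ j • x) : ej p q K i * x = 0 := by
  have h1 : q ^ i • (ej p q K i * x) = q ^ j • (ej p q K i * x) := by
    rw [← smul_mul_assoc, ← h.K_e, ← e_comm_K, mul_assoc, hx, mul_smul_comm]
  rw [← sub_eq_zero, ← sub_smul] at h1
  rcases smul_eq_zero.1 h1 with h2 | h2
  · exact absurd (q_zpow_eq h.hp h.hq _ _ (sub_eq_zero.1 h2)) hij
  · exact h2

lemma e_sum (h : Rl p q E F K L) : ∑ j ∈ range (2 * p), ej p q K (j : ℤ) = 1 := by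
  have hp := h.hp
  have hne : ((2 * p : ℕ) : ℂ) ≠ 0 := by
    rw [Nat.cast_ne_zero]; omega
  unfold ej
  rw [← smul_sum, sum_comm]
  simp_rw [← sum_smul]
  rw [sum_eq_single 0]
  · simp only [Nat.cast_zero, mul_zero, neg_zero, zpow_zero, sum_const, card_range, pow_zero]
    rw [smul_smul, nsmul_eq_mul, mul_one]
    push_cast at hne ⊢
    rw [inv_mul_cancel₀ hne, one_smul]
  · intro k hk hk0
    have h1 : ∑ j ∈ range (2 * p), q ^ (-((j : ℤ) * (k : ℤ))) = 0 := by
      have h2 : ∀ j : ℕ, q ^ (-((j : ℤ) * (k : ℤ))) = (q ^ (-(k : ℤ))) ^ j := by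
        intro j
        rw [← zpow_natCast, ← zpow_mul]; congr 1; ring
      simp_rw [h2]
      have h3 : q ^ (-(k : ℤ)) ≠ 1 := by
        intro h3
        have h4 := q_zpow_eq h.hp h.hq (-(k : ℤ)) 0 (by simpa using h3)
        have h5 : 2 * p ∣ k := by
          have : (2 * p : ℤ) ∣ (k : ℤ) := by simpa using h4
          exact_mod_cast this
        have := Nat.le_of_dvd (by omega) h5
        have := mem_range.1 hk
        omega
      have h4 := mul_geom_sum (q ^ (-(k : ℤ))) (2 * p)
      have h5 : (q ^ (-(k : ℤ))) ^ (2 * p) = 1 := by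
        rw [← zpow_natCast, ← zpow_mul, mul_comm, zpow_mul, zpow_natCast, h.hq.pow_eq_one, one_zpow]
      rw [h5, sub_self] at h4
      exact (mul_eq_zero.1 h4).resolve_left (sub_ne_zero.2 h3)
    rw [h1, zero_smul]
  · intro h0
    exact absurd (mem_range.2 (by omega)) h0

/-- it suffices to compare after multiplying with the projectors -/
lemma ext_e (h : Rl p q E F K L) {x y : A} (hxy : ∀ j : ℕ, x * ej p q K j = y * ej p q K j) :
    x = y := by
  rw [← mul_one x, ← mul_one y, ← h.e_sum, mul_sum, mul_sum]
  exact sum_congr rfl fun j _ => hxy j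

lemma EL (h : Rl p q E F K L) : E * L = q ^ 2 • (L * E) := by
  have h1 := congrArg (fun x => L * x * L) h.KE
  simp only [mul_smul_comm, smul_mul_assoc] at h1
  rw [← mul_assoc, h.LK, one_mul] at h1
  rw [h1, mul_assoc, mul_assoc E K L, h.KL, mul_one]

lemma LF (h : Rl p q E F K L) : L * F = q ^ 2 • (F * L) := by
  have h1 := congrArg (fun x => L * x * L) h.FK
  simp only [mul_smul_comm, smul_mul_assoc] at h1
  rw [← mul_assoc L K, h.LK, one_mul, mul_assoc, mul_assoc F K L, h.KL, mul_one] at h1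
  exact h1

lemma cas_K (h : Rl p q E F K L) : Commute (cas q E F K L) K := by
  have h1 : F * E * K = K * (F * E) := by
    have h2 : q ^ 2 • (F * E * K) = q ^ 2 • (K * (F * E)) := by
      rw [mul_assoc, ← mul_smul_comm, ← h.KE, ← mul_assoc, h.FK, smul_mul_assoc, mul_assoc]
    exact smul_right_injective A (pow_ne_zero 2 h.q0) h2
  unfold Commute SemiconjBy cas
  rw [add_mul, mul_add, h1]
  simp only [smul_mul_assoc, mul_smul_comm, add_mul, mul_add, h.KL, h.LK]

lemma cas_L (h : Rl p q E F K L) : Commute (cas q E F K L) L := by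
  have h1 := h.cas_K
  have : L * (cas q E F K L * K) * L = L * (K * cas q E F K L) * L := by rw [h1.eq]
  simp only [← mul_assoc, h.LK, one_mul] at this
  rw [mul_assoc, mul_assoc, h.KL, mul_one] at this
  exact this.symm

lemma coef (h : Rl p q E F K L) :
    (q - q⁻¹)⁻¹ = ((q - q⁻¹) ^ 2)⁻¹ * (q - q⁻¹) := by
  have := qq_ne h.hp h.hq
  field_simp

lemma cas_E (h : Rl p q E F K L) : Commute (cas q E F K L) E := by
  have h0 := h.q0
  unfold Commute SemiconjBy cas
  have h1 : E * K = (q ^ 2)⁻¹ • (K * E) := by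
    rw [h.KE, smul_smul, inv_mul_cancel₀ (pow_ne_zero 2 h0), one_smul]
  have h2 : E * (F * E) = F * E * E + (q - q⁻¹)⁻¹ • (K * E - L * E) := by
    rw [← sub_mul, ← smul_mul_assoc, ← h.EF]; noncomm_ring
  rw [mul_add, h2, add_mul, add_assoc]
  congr 1
  simp only [smul_mul_assoc, mul_smul_comm, add_mul, mul_add, h1, h.EL, h.coef, smul_smul]
  set κ := ((q - q⁻¹) ^ 2)⁻¹
  have a1 : q * (q ^ 2)⁻¹ = q⁻¹ := by field_simp
  have a2 : q⁻¹ * q ^ 2 = q := by field_simp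
  rw [a1, a2]
  module

lemma cas_F (h : Rl p q E F K L) : Commute (cas q E F K L) F := by
  have h0 := h.q0
  unfold Commute SemiconjBy cas
  have h1 : K * F = (q ^ 2)⁻¹ • (F * K) := by
    rw [h.FK, smul_smul, inv_mul_cancel₀ (pow_ne_zero 2 h0), one_smul]
  have h2 : F * E * F = F * (F * E) + (q - q⁻¹)⁻¹ • (F * K - F * L) := by
    rw [← mul_sub, ← mul_smul_comm, ← h.EF]; noncomm_ring
  rw [add_mul, h2, mul_add, add_assoc]
  congr 1
  simp only [smul_mul_assoc, mul_smul_comm, add_mul, mul_add, h1, h.LF, h.coef, smul_smul]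
  set κ := ((q - q⁻¹) ^ 2)⁻¹
  have a1 : q * (q ^ 2)⁻¹ = q⁻¹ := by field_simp
  have a2 : q⁻¹ * q ^ 2 = q := by field_simp
  rw [a1, a2]
  module

end Rl

lemma aeval_comm {A : Type*} [Ring A] [Algebra ℂ A] {c x : A} (h : Commute c x) (f : ℂ[X]) :
    Commute (aeval c f) x := by
  induction f using Polynomial.induction_on' with
  | add f g hf hg => rw [map_add]; exact hf.add_left hg
  | monomial n a =>
    rw [aeval_monomial]
    exact (show Commute (algebraMap ℂ A a) x from Algebra.commutes a x).mul_left (h.pow_left n)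

namespace Rl
variable {p : ℕ} {q : ℂ} {A : Type*} [Ring A] [Algebra ℂ A] {E F K L : A}

lemma FE_e (h : Rl p q E F K L) (j : ℤ) : F * E * ej p q K j
    = aeval (cas q E F K L) (X - C (cc q j)) * ej p q K j := by
  rw [map_sub, aeval_X, aeval_C, sub_mul, ← Algebra.smul_def]
  unfold cas
  rw [add_mul, smul_mul_assoc, add_mul, smul_mul_assoc, smul_mul_assoc, h.K_e, h.L_e]
  have : cc q j = ((q - q⁻¹) ^ 2)⁻¹ * (q * q ^ j + q⁻¹ * q ^ (-j)) := by
    unfold cc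
    rw [neg_add, zpow_add₀ h.q0, zpow_add₀ h.q0, zpow_one, zpow_neg_one]
    ring
  rw [this]
  module

lemma EF_e (h : Rl p q E F K L) (j : ℤ) : E * F * ej p q K j
    = aeval (cas q E F K L) (X - C (cc q (j - 2))) * ej p q K j := by
  have h1 : E * F = F * E + (q - q⁻¹)⁻¹ • (K - L) := by rw [← h.EF]; abel
  rw [h1, add_mul, h.FE_e, smul_mul_assoc, sub_mul, h.K_e, h.L_e]
  simp only [map_sub, aeval_X, aeval_C, sub_mul, ← Algebra.smul_def]
  have h0 := h.q0
  have : cc q (j - 2) = cc q j - (q - q⁻¹)⁻¹ * (q ^ j - q ^ (-j)) := by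
    rw [h.coef]
    unfold cc
    rw [show -(j - 2 + 1) = -j + 1 by ring, show j - 2 + 1 = j + (-1) by ring,
      show -(j + 1) = -j + (-1) by ring, zpow_add₀ h0, zpow_add₀ h0, zpow_add₀ h0, zpow_add₀ h0,
      zpow_one, zpow_neg_one]
    ring
  rw [this]
  module

lemma En_e (h : Rl p q E F K L) (j : ℤ) (n : ℕ) :
    E ^ n * ej p q K j = ej p q K (j + 2 * n) * E ^ n := by
  induction n with
  | zero => simp
  | succ n ih =>
    rw [pow_succ', mul_assoc, ih, ← mul_assoc, h.E_e, mul_assoc]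
    congr 2
    push_cast; ring

lemma Fn_e (h : Rl p q E F K L) (j : ℤ) (n : ℕ) :
    F ^ n * ej p q K j = ej p q K (j - 2 * n) * F ^ n := by
  induction n with
  | zero => simp
  | succ n ih =>
    rw [pow_succ', mul_assoc, ih, ← mul_assoc, h.F_e, mul_assoc]
    congr 2
    push_cast; ring

lemma FE_En (h : Rl p q E F K L) (j : ℤ) (n : ℕ) : F * E * (E ^ n * ej p q K j)
    = aeval (cas q E F K L) (X - C (cc q (j + 2 * n))) * (E ^ n * ej p q K j) := by
  rw [h.En_e, ← mul_assoc, h.FE_e, mul_assoc]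

lemma EF_Fn (h : Rl p q E F K L) (j : ℤ) (n : ℕ) : E * F * (F ^ n * ej p q K j)
    = aeval (cas q E F K L) (X - C (cc q (j - 2 * n - 2))) * (F ^ n * ej p q K j) := by
  rw [h.Fn_e, ← mul_assoc, h.EF_e, mul_assoc]

lemma FnEn (h : Rl p q E F K L) (j : ℤ) (n : ℕ) : F ^ n * (E ^ n * ej p q K j)
    = aeval (cas q E F K L) (∏ i ∈ range n, (X - C (cc q (j + 2 * (i : ℤ))))) * ej p q K j := by
  induction n with
  | zero => simp
  | succ n ih =>
    have h1 : F ^ (n + 1) * (E ^ (n + 1) * ej p q K j)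
        = F ^ n * (F * E * (E ^ n * ej p q K j)) := by
      rw [pow_succ F, pow_succ' E]; simp only [mul_assoc]
    rw [h1, h.FE_En, ← mul_assoc, ← ((aeval_comm h.cas_F _).pow_right n).eq, mul_assoc, ih,
      prod_range_succ, mul_comm (∏ i ∈ _, _), map_mul, mul_assoc]

lemma EnFn (h : Rl p q E F K L) (j : ℤ) (n : ℕ) : E ^ n * (F ^ n * ej p q K j)
    = aeval (cas q E F K L) (∏ i ∈ range n, (X - C (cc q (j - 2 * (i : ℤ) - 2))))
      * ej p q K j := by
  induction n with
  | zero => simp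
  | succ n ih =>
    have h1 : E ^ (n + 1) * (F ^ (n + 1) * ej p q K j)
        = E ^ n * (E * F * (F ^ n * ej p q K j)) := by
      rw [pow_succ E, pow_succ' F]; simp only [mul_assoc]
    rw [h1, h.EF_Fn, ← mul_assoc, ← ((aeval_comm h.cas_E _).pow_right n).eq, mul_assoc, ih,
      prod_range_succ, mul_comm (∏ i ∈ _, _), map_mul, mul_assoc]

lemma Psi_e (h : Rl p q E F K L) (j : ℤ) :
    aeval (cas q E F K L) (Psi p q j) * ej p q K j = 0 := by
  rw [Psi, ← h.FnEn, h.Fp, zero_mul]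

lemma D_E (h : Rl p q E F K L) (j : ℤ) :
    aeval (cas q E F K L) (Dp p q j) * (E * ej p q K j) = 0 := by
  rw [h.E_e, ← mul_assoc, Dp, ← h.FnEn, mul_assoc, mul_assoc, ← h.E_e, ← mul_assoc (E ^ _),
    ← pow_succ, Nat.sub_add_cancel (by have := h.hp; omega), h.Ep, zero_mul, mul_zero]

lemma D_F (h : Rl p q E F K L) (j : ℤ) :
    aeval (cas q E F K L) (Dp p q j) * (F * ej p q K (j + 2)) = 0 := by
  have h1 : Dp p q j = ∏ i ∈ range (p - 1), (X - C (cc q (j - 2 * (i : ℤ) - 2))) := by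
    unfold Dp
    rw [← prod_range_reflect]
    apply prod_congr rfl
    intro i hi
    rw [mem_range] at hi
    have : ((p - 1 - 1 - i : ℕ) : ℤ) = (p : ℤ) - 1 - 1 - i := by omega
    rw [this, ← cc_per h.hp h.hq (j - 2 * i - 2)]
    congr 3
    ring
  rw [h1, h.F_e, add_sub_cancel_right, ← mul_assoc, ← h.EnFn, mul_assoc, mul_assoc]
  have h2 : ej p q K j * F = F * ej p q K (j + 2) := by rw [h.F_e, add_sub_cancel_right]
  rw [h2, ← mul_assoc (F ^ _),
    ← pow_succ, Nat.sub_add_cancel (by have := h.hp; omega), h.Fp, zero_mul, mul_zero]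

/-- weight-zero part -/
lemma corner (h : Rl p q E F K L) (hgen : Algebra.adjoin ℂ {E, F, K, L} = ⊤) (j : ℤ) (u : A) :
    ∃ f : ℂ[X], ej p q K j * (u * ej p q K j) = aeval (cas q E F K L) f * ej p q K j := by
  set c := cas q E F K L with hc
  set e := ej p q K j with he
  set S : Submodule ℂ A := Submodule.span ℂ
    ({x | ∃ (g : ℂ[X]) (n : ℕ), x = aeval c g * (E ^ n * e)} ∪
      {x | ∃ (g : ℂ[X]) (n : ℕ), x = aeval c g * (F ^ n * e)}) with hS
  have mE : ∀ (g : ℂ[X]) (n : ℕ), aeval c g * (E ^ n * e) ∈ S := fun g n =>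
    Submodule.subset_span (Or.inl ⟨g, n, rfl⟩)
  have mF : ∀ (g : ℂ[X]) (n : ℕ), aeval c g * (F ^ n * e) ∈ S := fun g n =>
    Submodule.subset_span (Or.inr ⟨g, n, rfl⟩)
  have closed : ∀ y : A, (∀ (g : ℂ[X]) (n : ℕ), y * (aeval c g * (E ^ n * e)) ∈ S) →
      (∀ (g : ℂ[X]) (n : ℕ), y * (aeval c g * (F ^ n * e)) ∈ S) → ∀ s ∈ S, y * s ∈ S := by
    intro y h1 h2 s hs
    induction hs using Submodule.span_induction with
    | mem x hx =>
      rcases hx with ⟨g, n, rfl⟩ | ⟨g, n, rfl⟩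
      · exact h1 g n
      · exact h2 g n
    | zero => simp
    | add x y _ _ hx hy => rw [mul_add]; exact S.add_mem hx hy
    | smul a x _ hx => rw [mul_smul_comm]; exact S.smul_mem a hx
  have KEe : ∀ n : ℕ, K * (E ^ n * e) = q ^ (j + 2 * (n : ℤ)) • (E ^ n * e) := by
    intro n; rw [he, h.En_e, ← mul_assoc, h.K_e, smul_mul_assoc]
  have KFe : ∀ n : ℕ, K * (F ^ n * e) = q ^ (j - 2 * (n : ℤ)) • (F ^ n * e) := by
    intro n; rw [he, h.Fn_e, ← mul_assoc, h.K_e, smul_mul_assoc]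
  have LEe : ∀ n : ℕ, L * (E ^ n * e) = q ^ (-(j + 2 * (n : ℤ))) • (E ^ n * e) := by
    intro n; rw [he, h.En_e, ← mul_assoc, h.L_e, smul_mul_assoc]
  have LFe : ∀ n : ℕ, L * (F ^ n * e) = q ^ (-(j - 2 * (n : ℤ))) • (F ^ n * e) := by
    intro n; rw [he, h.Fn_e, ← mul_assoc, h.L_e, smul_mul_assoc]
  have mv : ∀ (y : A) (_ : Commute c y) (g : ℂ[X]) (x : A),
      y * (aeval c g * x) = aeval c g * (y * x) := by
    intro y hy g x
    rw [← mul_assoc, ← (aeval_comm hy g).eq, mul_assoc]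
  have all : ∀ y ∈ Algebra.adjoin ℂ {E, F, K, L}, ∀ s ∈ S, y * s ∈ S := by
    intro y hy
    induction hy using Algebra.adjoin_induction with
    | mem x hx =>
      simp only [Set.mem_insert_iff, Set.mem_singleton_iff] at hx
      rcases hx with rfl | rfl | rfl | rfl
      · apply closed
        · intro g n
          rw [mv _ h.cas_E, ← mul_assoc _ (_ ^ n), ← pow_succ']
          exact mE g _
        · intro g n
          rw [mv _ h.cas_E]
          rcases n with _ | n
          · have := mE g 1
            simpa using this
          · rw [pow_succ', mul_assoc, ← mul_assoc _ F, he, h.EF_Fn, ← mul_assoc, ← map_mul]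
            exact mF _ n
      · apply closed
        · intro g n
          rw [mv _ h.cas_F]
          rcases n with _ | n
          · have := mF g 1
            simpa using this
          · rw [pow_succ', mul_assoc, ← mul_assoc _ E, he, h.FE_En, ← mul_assoc, ← map_mul]
            exact mE _ n
        · intro g n
          rw [mv _ h.cas_F, ← mul_assoc _ (_ ^ n), ← pow_succ']
          exact mF g _
      · apply closed
        · intro g n
          rw [mv _ h.cas_K, KEe, mul_smul_comm]
          exact S.smul_mem _ (mE g n)
        · intro g n
          rw [mv _ h.cas_K, KFe, mul_smul_comm]
          exact S.smul_mem _ (mF g n)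
      · apply closed
        · intro g n
          rw [mv _ h.cas_L, LEe, mul_smul_comm]
          exact S.smul_mem _ (mE g n)
        · intro g n
          rw [mv _ h.cas_L, LFe, mul_smul_comm]
          exact S.smul_mem _ (mF g n)
    | algebraMap r => intro s hs; rw [← Algebra.smul_def]; exact S.smul_mem r hs
    | add x y _ _ hx hy => intro s hs; rw [add_mul]; exact S.add_mem (hx s hs) (hy s hs)
    | mul x y _ _ hx hy => intro s hs; rw [mul_assoc]; exact hx _ (hy s hs)
  have hu : u * e ∈ S := by
    apply all u (by rw [hgen]; trivial)
    have := mE 1 0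
    simpa using this
  have ce : Commute c e := by
    rw [he]
    unfold ej
    apply Commute.smul_right
    apply Commute.sum_right
    intro k _
    exact (h.cas_K.pow_right k).smul_right _
  have hp := h.hp
  have hn : ∀ n : ℕ, n ≠ 0 → n < p → ¬ (2 * p : ℤ) ∣ 2 * (n : ℤ) := by
    rintro n hn hnp hd
    have : 2 * p ∣ 2 * n := by exact_mod_cast hd
    have := Nat.le_of_dvd (by omega) this
    omega
  have fin : ∀ s ∈ S, ∃ f : ℂ[X], e * s = aeval c f * e := by
    intro s hs
    induction hs using Submodule.span_induction with
    | mem x hx =>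
      rcases hx with ⟨g, n, rfl⟩ | ⟨g, n, rfl⟩
      · rw [mv _ ce]
        by_cases h0 : n = 0
        · subst h0
          exact ⟨g, by rw [pow_zero, one_mul, he, h.e_idem]⟩
        · refine ⟨0, ?_⟩
          rw [map_zero, zero_mul]
          by_cases h1 : n < p
          · rw [he, h.e_zero j (j + 2 * n) ?_ _ (KEe n), mul_zero]
            rw [show j - (j + 2 * (n : ℤ)) = -(2 * (n : ℤ)) by ring, dvd_neg]
            exact hn n h0 h1
          · rw [pow_eq_zero_of_le (not_lt.1 h1) h.Ep]; simp
      · rw [mv _ ce]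
        by_cases h0 : n = 0
        · subst h0
          exact ⟨g, by rw [pow_zero, one_mul, he, h.e_idem]⟩
        · refine ⟨0, ?_⟩
          rw [map_zero, zero_mul]
          by_cases h1 : n < p
          · rw [he, h.e_zero j (j - 2 * n) ?_ _ (KFe n), mul_zero]
            rw [show j - (j - 2 * (n : ℤ)) = (2 * (n : ℤ)) by ring]
            exact hn n h0 h1
          · rw [pow_eq_zero_of_le (not_lt.1 h1) h.Fp]; simp
    | zero => exact ⟨0, by simp⟩
    | add x y _ _ hx hy =>
      obtain ⟨f, hf⟩ := hx
      obtain ⟨g, hg⟩ := hy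
      exact ⟨f + g, by rw [mul_add, hf, hg, map_add, add_mul]⟩
    | smul a x _ hx =>
      obtain ⟨f, hf⟩ := hx
      exact ⟨a • f, by rw [mul_smul_comm, hf, map_smul, smul_mul_assoc]⟩
  exact fin _ hu

end Rl
end LH

namespace LH
open Polynomial

section Model
variable (p : ℕ) (q : ℂ) (j : ℤ)

/-- The coefficient ring of the model module. -/
abbrev RR := AdjoinRoot (Psi p q j)

def yy (m : ℤ) : RR p q j := AdjoinRoot.root _ - algebraMap ℂ _ (cc q (j + 2 * m))

def aa (m : ℤ) : RR p q j := if 0 ≤ m then yy p q j m else 1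
def bb (m : ℤ) : RR p q j := if 0 ≤ m then 1 else yy p q j m

def QQ (s t : ℤ) : RR p q j :=
  (∏ i ∈ Finset.Ico 0 t, yy p q j i) * ∏ i ∈ Finset.Ico s 0, yy p q j i

lemma aa_mul_bb (m : ℤ) : aa p q j m * bb p q j m = yy p q j m := by
  unfold aa bb; split_ifs <;> simp

lemma aa_QQ (s t : ℤ) : aa p q j t * QQ p q j s t = QQ p q j s (t + 1) := by
  unfold aa QQ
  rw [← mul_assoc]
  congr 1
  split_ifs with h
  · have : Finset.Ico 0 (t + 1) = insert t (Finset.Ico 0 t) := by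
      ext i; simp only [Finset.mem_Ico, Finset.mem_insert]; omega
    rw [this, prod_insert (by simp)]
  · have h1 : Finset.Ico 0 t = ∅ := Finset.Ico_eq_empty_of_le (by omega)
    have h2 : Finset.Ico 0 (t + 1) = ∅ := Finset.Ico_eq_empty_of_le (by omega)
    rw [h1, h2]; simp

lemma bb_QQ (s t : ℤ) : bb p q j s * QQ p q j (s + 1) t = QQ p q j s t := by
  unfold bb QQ
  rw [mul_left_comm]
  congr 1
  split_ifs with h
  · have h1 : Finset.Ico s 0 = ∅ := Finset.Ico_eq_empty_of_le (by omega)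
    have h2 : Finset.Ico (s + 1) 0 = ∅ := Finset.Ico_eq_empty_of_le (by omega)
    rw [h1, h2]; simp
  · have : Finset.Ico s 0 = insert s (Finset.Ico (s + 1) 0) := by
      ext i; simp only [Finset.mem_Ico, Finset.mem_insert]; omega
    rw [this, prod_insert (by simp)]

lemma QQ_dvd (s t s' t' : ℤ) (hs : s' ≤ s) (ht : t ≤ t') : QQ p q j s t ∣ QQ p q j s' t' :=
  mul_dvd_mul
    (prod_dvd_prod_of_subset _ _ _ (Finset.Ico_subset_Ico le_rfl ht))
    (prod_dvd_prod_of_subset _ _ _ (Finset.Ico_subset_Ico hs le_rfl))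

variable {p q} in
lemma QQ_zero (hp : 2 ≤ p) (hq : IsPrimitiveRoot q (2 * p)) (s : ℤ) :
    QQ p q j s (s + p) = 0 := by
  have h1 : ∏ i ∈ range p, yy p q j (s + i) = 0 := by
    rw [prod_window p (yy p q j)]
    · have := AdjoinRoot.aeval_eq (f := Psi p q j) (Psi p q j)
      rw [AdjoinRoot.mk_self] at this
      have e : (∏ i ∈ range p, yy p q j (i : ℤ)) = aeval (AdjoinRoot.root (Psi p q j))
          (∏ i ∈ range p, (X - C (cc q (j + 2 * (i : ℤ))))) := by
        rw [map_prod]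
        apply prod_congr rfl
        intro i _
        simp [yy]
      exact e.trans this
    · intro i
      unfold yy
      rw [← cc_per hp hq (j + 2 * i)]
      congr 3
      ring
  have h2 : ∏ i ∈ Finset.Ico s (s + p), yy p q j i = ∏ i ∈ range p, yy p q j (s + i) := by
    symm
    refine prod_nbij (fun i : ℕ => s + (i : ℤ)) ?_ ?_ ?_ ?_
    · intro i hi
      have := mem_range.1 hi
      simp only [Finset.mem_Ico]; omega
    · intro a _ b _ hab
      simpa using hab
    · intro x hx
      simp only [coe_Ico, Set.mem_Ico] at hx
      refine ⟨(x - s).toNat, ?_, ?_⟩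
      · simp only [coe_range, Set.mem_Iio]; omega
      · simp only; omega
    · intro i _; rfl
  have h3 : ∏ i ∈ Finset.Ico s (s + p), yy p q j i ∣ QQ p q j s (s + p) := by
    unfold QQ
    rw [← prod_union]
    · apply prod_dvd_prod_of_subset
      intro i
      simp only [Finset.mem_Ico, Finset.mem_union]; omega
    · rw [Finset.disjoint_left]
      intro i
      simp only [Finset.mem_Ico]; omega
  rw [h2, h1] at h3
  exact zero_dvd_iff.1 h3

def WE : (ℤ → RR p q j) →ₗ[ℂ] (ℤ → RR p q j) where
  toFun φ m := aa p q j (m - 1) * φ (m - 1)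
  map_add' x y := by ext m; simp [mul_add]
  map_smul' r x := by ext m; simp

def WF : (ℤ → RR p q j) →ₗ[ℂ] (ℤ → RR p q j) where
  toFun φ m := bb p q j m * φ (m + 1)
  map_add' x y := by ext m; simp [mul_add]
  map_smul' r x := by ext m; simp

def WK : (ℤ → RR p q j) →ₗ[ℂ] (ℤ → RR p q j) where
  toFun φ m := (q ^ (j + 2 * m)) • φ m
  map_add' x y := by ext m; simp
  map_smul' r x := by ext m; simp [smul_comm r]

def WL : (ℤ → RR p q j) →ₗ[ℂ] (ℤ → RR p q j) where
  toFun φ m := (q ^ (-(j + 2 * m))) • φ m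
  map_add' x y := by ext m; simp
  map_smul' r x := by ext m; simp [smul_comm r]

/-- The model module. -/
def MM : Submodule ℂ (ℤ → RR p q j) where
  carrier := {φ | ∀ m, QQ p q j m m ∣ φ m}
  add_mem' hx hy m := dvd_add (hx m) (hy m)
  zero_mem' m := dvd_zero _
  smul_mem' r x hx m := by
    rw [Pi.smul_apply, Algebra.smul_def]
    exact (hx m).mul_left _

lemma WE_pow (φ : ℤ → RR p q j) (hφ : φ ∈ MM p q j) (n : ℕ) (m : ℤ) :
    QQ p q j (m - n) m ∣ ((WE p q j) ^ n) φ m := by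
  induction n generalizing m with
  | zero => simpa using hφ m
  | succ n ih =>
    rw [pow_succ', Module.End.mul_apply]
    change _ ∣ aa p q j (m - 1) * ((WE p q j) ^ n) φ (m - 1)
    have h1 := aa_QQ p q j (m - 1 - n) (m - 1)
    rw [sub_add_cancel] at h1
    rw [show m - ((n + 1 : ℕ) : ℤ) = m - 1 - n by push_cast; ring, ← h1]
    exact mul_dvd_mul_left _ (ih _)

lemma WF_pow (φ : ℤ → RR p q j) (hφ : φ ∈ MM p q j) (n : ℕ) (m : ℤ) :
    QQ p q j m (m + n) ∣ ((WF p q j) ^ n) φ m := by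
  induction n generalizing m with
  | zero => simpa using hφ m
  | succ n ih =>
    rw [pow_succ', Module.End.mul_apply]
    change _ ∣ bb p q j m * ((WF p q j) ^ n) φ (m + 1)
    rw [← bb_QQ]
    rw [show m + ((n + 1 : ℕ) : ℤ) = m + 1 + n by push_cast; ring]
    exact mul_dvd_mul_left _ (ih _)

lemma WE_mem : ∀ φ ∈ MM p q j, WE p q j φ ∈ MM p q j := by
  intro φ hφ m
  have := WE_pow p q j φ hφ 1 m
  rw [pow_one] at this
  exact (QQ_dvd p q j m m (m - (1 : ℕ)) m (by simp) le_rfl).trans this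

lemma WF_mem : ∀ φ ∈ MM p q j, WF p q j φ ∈ MM p q j := by
  intro φ hφ m
  have := WF_pow p q j φ hφ 1 m
  rw [pow_one] at this
  exact (QQ_dvd p q j m m m (m + (1 : ℕ)) le_rfl (by simp)).trans this

lemma WK_mem : ∀ φ ∈ MM p q j, WK p q j φ ∈ MM p q j := by
  intro φ hφ m
  change _ ∣ (q ^ (j + 2 * m)) • φ m
  rw [Algebra.smul_def]
  exact (hφ m).mul_left _

lemma WL_mem : ∀ φ ∈ MM p q j, WL p q j φ ∈ MM p q j := by
  intro φ hφ m
  change _ ∣ (q ^ (-(j + 2 * m))) • φ m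
  rw [Algebra.smul_def]
  exact (hφ m).mul_left _

def ME : Module.End ℂ (MM p q j) := (WE p q j).restrict (WE_mem p q j)
def MF : Module.End ℂ (MM p q j) := (WF p q j).restrict (WF_mem p q j)
def MK : Module.End ℂ (MM p q j) := (WK p q j).restrict (WK_mem p q j)
def ML : Module.End ℂ (MM p q j) := (WL p q j).restrict (WL_mem p q j)

lemma ME_apply (φ : MM p q j) (m : ℤ) :
    (ME p q j φ : ℤ → RR p q j) m = aa p q j (m - 1) * (φ : ℤ → RR p q j) (m - 1) := rfl
lemma MF_apply (φ : MM p q j) (m : ℤ) :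
    (MF p q j φ : ℤ → RR p q j) m = bb p q j m * (φ : ℤ → RR p q j) (m + 1) := rfl
lemma MK_apply (φ : MM p q j) (m : ℤ) :
    (MK p q j φ : ℤ → RR p q j) m = (q ^ (j + 2 * m)) • (φ : ℤ → RR p q j) m := rfl
lemma ML_apply (φ : MM p q j) (m : ℤ) :
    (ML p q j φ : ℤ → RR p q j) m = (q ^ (-(j + 2 * m))) • (φ : ℤ → RR p q j) m := rfl

variable {p q} in
lemma model_rl (hp : 2 ≤ p) (hq : IsPrimitiveRoot q (2 * p)) :
    Rl p q (ME p q j) (MF p q j) (MK p q j) (ML p q j) := by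
  have h0 := q_ne hp hq
  have MKpow : ∀ (n : ℕ) (φ : MM p q j) (m : ℤ), (((MK p q j) ^ n) φ : ℤ → RR p q j) m
      = ((q ^ (j + 2 * m)) ^ n) • (φ : ℤ → RR p q j) m := by
    intro n
    induction n with
    | zero => intro φ m; simp
    | succ n ih =>
      intro φ m
      rw [pow_succ', Module.End.mul_apply, MK_apply, ih, smul_smul, ← pow_succ']
  refine ⟨hp, hq, ?_, ?_, ?_, ?_, ?_, ?_, ?_, ?_⟩
  · refine LinearMap.ext fun φ => Subtype.ext (funext fun m => ?_)
    rw [ME, Module.End.pow_restrict]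
    change ((WE p q j) ^ p) φ m = 0
    have := WE_pow p q j φ φ.2 p m
    have h1 := QQ_zero j hp hq (m - p)
    rw [sub_add_cancel] at h1
    rw [h1] at this
    exact zero_dvd_iff.1 this
  · refine LinearMap.ext fun φ => Subtype.ext (funext fun m => ?_)
    rw [MF, Module.End.pow_restrict]
    change ((WF p q j) ^ p) φ m = 0
    have := WF_pow p q j φ φ.2 p m
    rw [QQ_zero j hp hq m] at this
    exact zero_dvd_iff.1 this
  · refine LinearMap.ext fun φ => Subtype.ext (funext fun m => ?_)
    rw [MKpow, ← zpow_natCast, ← zpow_mul, mul_comm, zpow_mul, zpow_natCast, hq.pow_eq_one,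
      one_zpow, one_smul]
    rfl
  · refine LinearMap.ext fun φ => Subtype.ext (funext fun m => ?_)
    rw [Module.End.mul_apply, MK_apply, ML_apply, smul_smul, ← zpow_add₀ h0]
    simp
  · refine LinearMap.ext fun φ => Subtype.ext (funext fun m => ?_)
    rw [Module.End.mul_apply, ML_apply, MK_apply, smul_smul, ← zpow_add₀ h0]
    simp
  · refine LinearMap.ext fun φ => Subtype.ext (funext fun m => ?_)
    rw [LinearMap.smul_apply, Submodule.coe_smul, Pi.smul_apply, Module.End.mul_apply,
      Module.End.mul_apply, MK_apply, ME_apply, ME_apply, MK_apply, mul_smul_comm, smul_smul]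
    congr 1
    rw [← zpow_natCast q 2, ← zpow_add₀ h0]
    congr 1
    push_cast; ring
  · refine LinearMap.ext fun φ => Subtype.ext (funext fun m => ?_)
    rw [LinearMap.smul_apply, Submodule.coe_smul, Pi.smul_apply, Module.End.mul_apply,
      Module.End.mul_apply, MK_apply, MF_apply, MF_apply, MK_apply, mul_smul_comm, smul_smul]
    congr 1
    rw [← zpow_natCast q 2, ← zpow_add₀ h0]
    congr 1
    push_cast; ring
  · refine LinearMap.ext fun φ => Subtype.ext (funext fun m => ?_)
    rw [LinearMap.smul_apply, Submodule.coe_smul, Pi.smul_apply, LinearMap.sub_apply,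
      LinearMap.sub_apply, Submodule.coe_sub, Submodule.coe_sub, Pi.sub_apply, Pi.sub_apply,
      Module.End.mul_apply, Module.End.mul_apply, ME_apply, MF_apply, MF_apply, ME_apply,
      MK_apply, ML_apply, sub_add_cancel, add_sub_cancel_right, ← mul_assoc, ← mul_assoc,
      mul_comm (bb p q j m), aa_mul_bb, aa_mul_bb, ← sub_mul, ← sub_smul, smul_smul,
      Algebra.smul_def]
    congr 1
    unfold yy
    rw [sub_sub_sub_cancel_left, ← map_sub]
    congr 1
    have h1 := qq_ne hp hq
    have h3 : (q - q⁻¹)⁻¹ = ((q - q⁻¹) ^ 2)⁻¹ * (q - q⁻¹) := by field_simp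
    rw [h3, show j + 2 * (m - 1) = (j + 2 * m) - 2 by ring]
    generalize j + 2 * m = n
    unfold cc
    rw [show n - 2 + 1 = n + (-1) by ring,
      show -(n + (-1)) = -n + 1 by ring,
      show -(n + 1) = -n + (-1) by ring, zpow_add₀ h0, zpow_add₀ h0,
      zpow_add₀ h0, zpow_add₀ h0, zpow_one, zpow_neg_one]
    ring

variable {p q} in
lemma model_cas (hp : 2 ≤ p) (hq : IsPrimitiveRoot q (2 * p)) (φ : MM p q j) (m : ℤ) :
    (cas q (ME p q j) (MF p q j) (MK p q j) (ML p q j) φ : ℤ → RR p q j) m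
      = AdjoinRoot.root _ * (φ : ℤ → RR p q j) m := by
  have h0 := q_ne hp hq
  unfold cas
  simp only [LinearMap.add_apply, LinearMap.smul_apply, Module.End.mul_apply,
    Submodule.coe_add, Submodule.coe_smul, Pi.add_apply, Pi.smul_apply, MF_apply, ME_apply,
    MK_apply, ML_apply, add_sub_cancel_right]
  rw [← mul_assoc, mul_comm (bb p q j m), aa_mul_bb, smul_smul, smul_smul, ← add_smul, smul_smul,
    Algebra.smul_def, ← add_mul]
  congr 1
  have : ((q - q⁻¹) ^ 2)⁻¹ * (q * q ^ (j + 2 * m) + q⁻¹ * q ^ (-(j + 2 * m))) =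
      cc q (j + 2 * m) := by
    generalize j + 2 * m = n
    unfold cc
    rw [neg_add, zpow_add₀ h0, zpow_add₀ h0, zpow_one, zpow_neg_one]
    ring
  rw [this]
  unfold yy
  ring

variable {p q} in
lemma model_faithful (hp : 2 ≤ p) (hq : IsPrimitiveRoot q (2 * p)) (f : ℂ[X])
    (hf : aeval (cas q (ME p q j) (MF p q j) (MK p q j) (ML p q j)) f * ej p q (MK p q j) j = 0) :
    Psi p q j ∣ f := by
  have h0 := q_ne hp hq
  set c := cas q (ME p q j) (MF p q j) (MK p q j) (ML p q j) with hc
  have hpow : ∀ (n : ℕ) (φ : MM p q j) (m : ℤ), ((c ^ n) φ : ℤ → RR p q j) m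
      = (AdjoinRoot.root _) ^ n * (φ : ℤ → RR p q j) m := by
    intro n
    induction n with
    | zero => intro φ m; simp
    | succ n ih =>
      intro φ m
      rw [pow_succ', Module.End.mul_apply, hc, model_cas j hp hq, ← hc, ih, ← mul_assoc, ← pow_succ']
  have hae : ∀ (g : ℂ[X]) (φ : MM p q j) (m : ℤ), ((aeval c g) φ : ℤ → RR p q j) m
      = AdjoinRoot.mk _ g * (φ : ℤ → RR p q j) m := by
    intro g φ m
    induction g using Polynomial.induction_on' with
    | add f g hf hg =>
      rw [map_add, LinearMap.add_apply, Submodule.coe_add, Pi.add_apply, hf, hg, map_add, add_mul]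
    | monomial n a =>
      rw [aeval_monomial, ← Algebra.smul_def, LinearMap.smul_apply, Submodule.coe_smul,
        Pi.smul_apply, hpow, ← AdjoinRoot.aeval_eq, aeval_monomial, Algebra.smul_def, mul_assoc]
  let d : MM p q j := ⟨Pi.single 0 1, by
    intro m
    by_cases hm : m = 0
    · subst hm
      simp [QQ]
    · rw [Pi.single_eq_of_ne hm]; exact dvd_zero _⟩
  have hKd : MK p q j d = (q ^ j) • d := by
    refine Subtype.ext (funext fun m => ?_)
    rw [MK_apply, Submodule.coe_smul, Pi.smul_apply]
    by_cases hm : m = 0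
    · subst hm; simp
    · change _ • (Pi.single 0 1 : ℤ → RR p q j) m = _ • (Pi.single 0 1 : ℤ → RR p q j) m
      rw [Pi.single_eq_of_ne hm]; simp
  have hKn : ∀ n : ℕ, ((MK p q j) ^ n) d = (q ^ (j * n)) • d := by
    intro n
    induction n with
    | zero => simp
    | succ n ih =>
      rw [pow_succ', Module.End.mul_apply, ih, map_smul, hKd, smul_smul, ← zpow_add₀ h0]
      congr 2
      push_cast; ring
  have hed : ej p q (MK p q j) j d = d := by
    have hne : ((2 * p : ℕ) : ℂ) ≠ 0 := by
      rw [Nat.cast_ne_zero]; omega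
    unfold ej
    rw [LinearMap.smul_apply, LinearMap.sum_apply]
    have e1 : ∀ k ∈ range (2 * p), ((q ^ (-(j * (k : ℤ)))) • (MK p q j) ^ k) d = d := by
      intro k _
      rw [LinearMap.smul_apply, hKn, smul_smul, ← zpow_add₀ h0]; simp
    rw [sum_congr rfl e1, sum_const, card_range, ← Nat.cast_smul_eq_nsmul ℂ, smul_smul]
    push_cast at hne ⊢
    rw [inv_mul_cancel₀ hne, one_smul]
  have h1 := congrArg (fun T : Module.End ℂ (MM p q j) => (T d : ℤ → RR p q j) 0) hf
  simp only [Module.End.mul_apply, hed, hae] at h1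
  have h2 : AdjoinRoot.mk (Psi p q j) f = 0 := by simpa [d] using h1
  exact AdjoinRoot.mk_eq_zero.1 h2

end Model
end LH

namespace LH
open Polynomial

section Count

/-- Extension of a tuple by zero (shifted by one). -/
def ex (p : ℕ) (n : ℤ) : (Fin (p - 1) → ℂ) →ₗ[ℂ] ℂ :=
  if h : 0 < n ∧ n < p then LinearMap.proj ⟨n.toNat - 1, by omega⟩ else 0

/-- The odd periodic extension of a tuple. -/
def atL (p : ℕ) (j : ℤ) : (Fin (p - 1) → ℂ) →ₗ[ℂ] ℂ :=
  ex p ((j + 1) % (2 * p)) - ex p (2 * p - (j + 1) % (2 * p))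

lemma ex_pos {p : ℕ} {n : ℤ} (h : 0 < n ∧ n < p) (a : Fin (p - 1) → ℂ) :
    ex p n a = a ⟨n.toNat - 1, by omega⟩ := by
  unfold ex; rw [dif_pos h]; rfl

lemma ex_neg {p : ℕ} {n : ℤ} (h : ¬ (0 < n ∧ n < p)) : ex p n = 0 := by
  unfold ex; rw [dif_neg h]

lemma atL_eq {p : ℕ} (j n m : ℤ) (h0 : 0 ≤ n) (h1 : n < 2 * p) (h : j + 1 = n + 2 * p * m) :
    atL p j = ex p n - ex p (2 * p - n) := by
  unfold atL
  rw [h, Int.add_mul_emod_self_left, Int.emod_eq_of_lt h0 h1]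

lemma rep {p : ℕ} (hp : 2 ≤ p) (j : ℤ) :
    ∃ n m : ℤ, 0 ≤ n ∧ n < 2 * p ∧ j + 1 = n + 2 * p * m :=
  ⟨(j + 1) % (2 * p), (j + 1) / (2 * p), Int.emod_nonneg _ (by omega),
    Int.emod_lt_of_pos _ (by omega), (Int.emod_add_mul_ediv _ _).symm⟩

lemma atL_per {p : ℕ} (hp : 2 ≤ p) (j m : ℤ) : atL p (j + 2 * p * m) = atL p j := by
  obtain ⟨n, m', h0, h1, h2⟩ := rep hp j
  rw [atL_eq j n m' h0 h1 h2, atL_eq _ n (m' + m) h0 h1]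
  linear_combination h2

lemma atL_odd {p : ℕ} (hp : 2 ≤ p) (j : ℤ) : atL p j + atL p (-2 - j) = 0 := by
  obtain ⟨n, m, h0, h1, h2⟩ := rep hp j
  rw [atL_eq j n m h0 h1 h2]
  by_cases hn : n = 0
  · subst hn
    rw [atL_eq (-2 - j) 0 (-m) le_rfl h1 (by linear_combination -h2)]
    rw [ex_neg (by omega), ex_neg (by omega)]
    simp
  · rw [atL_eq (-2 - j) (2 * p - n) (-m - 1) (by omega) (by omega) (by linear_combination -h2)]
    rw [show (2 * p - (2 * p - n) : ℤ) = n by ring]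
    abel

lemma atL_nat {p : ℕ} (a : Fin (p - 1) → ℂ) (i : Fin (p - 1)) : atL p ((i : ℕ) : ℤ) a = a i := by
  have hi := i.2
  rw [atL_eq _ ((i : ℕ) + 1) 0 (by omega) (by omega) (by ring), LinearMap.sub_apply,
    ex_pos (by omega), ex_neg (by omega)]
  rw [LinearMap.zero_apply, sub_zero]
  congr 1

lemma atL_of_odd {p : ℕ} (hp : 2 ≤ p) (a : ℤ → ℂ) (ha : ∀ j m : ℤ, a (j + 2 * p * m) = a j)
    (hodd : ∀ j, a j + a (-2 - j) = 0) (j : ℤ) :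
    atL p j (fun i : Fin (p - 1) => a ((i : ℕ) : ℤ)) = a j := by
  obtain ⟨n, m, h0, h1, h2⟩ := rep hp j
  rw [atL_eq j n m h0 h1 h2]
  have hj : a j = a (n - 1) := by
    rw [← ha (n - 1) m]; congr 1; linear_combination h2
  have ho := hodd (n - 1)
  have e1 : a (-2 - (n - 1)) = a (2 * p - n - 1) := by
    rw [← ha (-2 - (n - 1)) 1]; congr 1; ring
  rw [e1] at ho
  rw [hj, LinearMap.sub_apply]
  rcases lt_trichotomy n p with hlt | heq | hgt
  · rw [ex_neg (n := 2 * p - n) (by omega), LinearMap.zero_apply, sub_zero]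
    by_cases hn : n = 0
    · subst hn
      rw [ex_neg (by omega), LinearMap.zero_apply]
      have e2 : a (2 * p - 0 - 1) = a (0 - 1) := by
        rw [← ha (0 - 1) 1]; congr 1; ring
      rw [e2] at ho
      linear_combination -(1 / 2 : ℂ) * ho
    · rw [ex_pos (by omega)]
      congr 1
      simp only
      omega
  · rw [ex_neg (by omega), ex_neg (by omega)]
    have e2 : (2 * p - n - 1 : ℤ) = n - 1 := by omega
    rw [e2] at ho
    rw [LinearMap.zero_apply]
    linear_combination -(1 / 2 : ℂ) * ho
  · rw [ex_neg (n := n) (by omega), ex_pos (by omega), LinearMap.zero_apply]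
    have e2 : (((2 * p - n).toNat - 1 : ℕ) : ℤ) = 2 * p - n - 1 := by omega
    simp only [e2]
    linear_combination -ho

/-- The parameter space. -/
abbrev VV (p : ℕ) := (degreeLT ℂ p) × (degreeLT ℂ p) × (Fin (p - 1) → ℂ)

def baseL (p : ℕ) (r : ℕ) : VV p →ₗ[ℂ] ℂ[X] :=
  if r = 0 then (degreeLT ℂ p).subtype ∘ₗ LinearMap.fst ℂ _ _
  else (degreeLT ℂ p).subtype ∘ₗ LinearMap.fst ℂ _ _ ∘ₗ LinearMap.snd ℂ _ _

def stepL (p : ℕ) (q : ℂ) (k : ℤ) : VV p →ₗ[ℂ] ℂ[X] :=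
  (LinearMap.toSpanSingleton ℂ ℂ[X] (Dp p q k)) ∘ₗ atL p k ∘ₗ LinearMap.snd ℂ _ _ ∘ₗ
    LinearMap.snd ℂ _ _

lemma stepL_apply (p : ℕ) (q : ℂ) (k : ℤ) (v : VV p) :
    stepL p q k v = C (atL p k v.2.2) * Dp p q k := by
  rw [← smul_eq_C_mul]; rfl

def fL (p : ℕ) (q : ℂ) (j : ℕ) : VV p →ₗ[ℂ] ℂ[X] :=
  baseL p (j % 2) + ∑ i ∈ range (j / 2), stepL p q (((j % 2 : ℕ) : ℤ) + 2 * (i : ℤ))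

variable {p : ℕ} {q : ℂ}

lemma fL_zero (v : VV p) : fL p q 0 v = v.1 := by
  simp [fL, baseL]

lemma fL_one (v : VV p) : fL p q 1 v = v.2.1 := by
  simp [fL, baseL]

lemma fL_step (j : ℕ) (v : VV p) :
    fL p q (j + 2) v = fL p q j v + C (atL p j v.2.2) * Dp p q j := by
  have e1 : ((j % 2 : ℕ) : ℤ) + 2 * ((j / 2 : ℕ) : ℤ) = (j : ℤ) := by omega
  have e2 : fL p q (j + 2) = fL p q j + stepL p q (j : ℤ) := by
    unfold fL
    rw [Nat.add_mod_right, Nat.add_div_right j (by norm_num : 0 < 2), sum_range_succ, e1,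
      add_assoc]
  rw [e2, LinearMap.add_apply, stepL_apply]

lemma fL_add (j n : ℕ) (v : VV p) :
    fL p q (j + 2 * n) v = fL p q j v +
      ∑ i ∈ range n, C (atL p ((j : ℤ) + 2 * (i : ℤ)) v.2.2) * Dp p q ((j : ℤ) + 2 * (i : ℤ)) := by
  induction n with
  | zero => simp
  | succ n ih =>
    rw [show j + 2 * (n + 1) = (j + 2 * n) + 2 by ring, fL_step, ih, sum_range_succ, add_assoc]
    push_cast
    rfl

lemma fL_per (hp : 2 ≤ p) (hq : IsPrimitiveRoot q (2 * p)) (j : ℕ) (v : VV p) :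
    fL p q (j + 2 * p) v = fL p q j v := by
  rw [fL_add, sum_of_odd hp hq (fun k => atL p k v.2.2), add_zero]
  · intro j m
    rw [atL_per hp]
  · intro j
    rw [← LinearMap.add_apply, atL_odd hp, LinearMap.zero_apply]

lemma CDp_mem (hp : 2 ≤ p) (a : ℂ) (k : ℤ) : C a * Dp p q k ∈ degreeLT ℂ p := by
  rw [← smul_eq_C_mul]
  apply Submodule.smul_mem
  rw [mem_degreeLT, degree_eq_natDegree (Dp_monic k).ne_zero, Dp_natDeg]
  exact_mod_cast (by omega : p - 1 < p)

lemma fL_mem (hp : 2 ≤ p) (j : ℕ) (v : VV p) : fL p q j v ∈ degreeLT ℂ p := by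
  induction j using Nat.twoStepInduction with
  | zero => rw [fL_zero]; exact v.1.2
  | one => rw [fL_one]; exact v.2.1.2
  | more n ih _ =>
    rw [fL_step]
    exact Submodule.add_mem _ ih (CDp_mem hp _ _)

variable {A : Type*} [Ring A] [Algebra ℂ A] {E F K L : A}

def Phi (p : ℕ) (q : ℂ) {A : Type*} [Ring A] [Algebra ℂ A] (E F K L : A) : VV p →ₗ[ℂ] A :=
  ∑ j ∈ range (2 * p), (LinearMap.mulRight ℂ (ej p q K (j : ℤ))) ∘ₗ
    (aeval (cas q E F K L)).toLinearMap ∘ₗ fL p q j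

lemma Phi_e (h : Rl p q E F K L) (v : VV p) (i : ℕ) :
    Phi p q E F K L v * ej p q K i = aeval (cas q E F K L) (fL p q i v) * ej p q K i := by
  induction i using Nat.strong_induction_on with
  | _ i ih =>
    by_cases hi : i < 2 * p
    · unfold Phi
      rw [LinearMap.sum_apply, sum_mul, sum_eq_single i]
      · change aeval (cas q E F K L) (fL p q i v) * ej p q K i * ej p q K i = _
        rw [mul_assoc, h.e_idem]
      · intro j hj hji
        change aeval (cas q E F K L) (fL p q j v) * ej p q K j * ej p q K i = _
        rw [mul_assoc, h.e_zero j i _ _ (h.K_e i), mul_zero]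
        intro hd
        have hj := mem_range.1 hj
        have := Int.eq_zero_of_abs_lt_dvd hd (by rw [abs_lt]; omega)
        omega
      · intro hn
        exact absurd (mem_range.2 hi) hn
    · obtain ⟨k, rfl⟩ := Nat.exists_eq_add_of_le' (not_lt.1 hi)
      have := ih k (by have := h.hp; omega)
      rw [fL_per h.hp h.hq]
      push_cast
      rw [h.e_per]
      exact this

lemma ext_e2 (h : Rl p q E F K L) {x y : A}
    (hxy : ∀ j : ℕ, x * ej p q K (j + 2) = y * ej p q K (j + 2)) : x = y := by
  apply h.ext_e
  intro j
  have hp := h.hp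
  have := hxy (j + 2 * p - 2)
  rw [show (((j + 2 * p - 2 : ℕ) : ℤ) + 2) = j + 2 * p by omega, h.e_per] at this
  exact this

lemma mv {c y : A} (hy : Commute c y) (g : ℂ[X]) (x : A) :
    y * (aeval c g * x) = aeval c g * (y * x) := by
  rw [← mul_assoc, ← (aeval_comm hy g).eq, mul_assoc]

lemma mem_center_of_gen (hgen : Algebra.adjoin ℂ {E, F, K, L} = ⊤) {z : A}
    (hE : z * E = E * z) (hF : z * F = F * z) (hK : z * K = K * z) (hL : z * L = L * z) :
    z ∈ Subalgebra.center ℂ A := by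
  rw [Subalgebra.mem_center_iff]
  intro b
  have hb : b ∈ Algebra.adjoin ℂ {E, F, K, L} := by rw [hgen]; trivial
  induction hb using Algebra.adjoin_induction with
  | mem x hx =>
    simp only [Set.mem_insert_iff, Set.mem_singleton_iff] at hx
    rcases hx with rfl | rfl | rfl | rfl
    · exact hE.symm
    · exact hF.symm
    · exact hK.symm
    · exact hL.symm
  | algebraMap r => exact Algebra.commutes r z
  | add x y _ _ hx hy => rw [add_mul, mul_add, hx, hy]
  | mul x y _ _ hx hy => rw [mul_assoc, hy, ← mul_assoc, hx, mul_assoc]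

lemma Phi_mem (h : Rl p q E F K L) (hgen : Algebra.adjoin ℂ {E, F, K, L} = ⊤) (v : VV p) :
    Phi p q E F K L v ∈ Subalgebra.center ℂ A := by
  set z := Phi p q E F K L v with hz
  have ze : ∀ i : ℕ, z * ej p q K i = aeval (cas q E F K L) (fL p q i v) * ej p q K i := Phi_e h v
  apply mem_center_of_gen hgen
  · apply h.ext_e
    intro i
    have h2 := ze (i + 2)
    push_cast at h2
    rw [mul_assoc, h.E_e, ← mul_assoc, h2, mul_assoc, ← h.E_e, mul_assoc, ze, mv h.cas_E,
      fL_step, map_add, map_mul, aeval_C, add_mul, mul_assoc, h.D_E, mul_zero, add_zero]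
  · apply ext_e2 h
    intro i
    have h2 := ze (i + 2)
    push_cast at h2
    rw [mul_assoc, h.F_e, add_sub_cancel_right, ← mul_assoc, ze, mul_assoc F, h2, mv h.cas_F,
      fL_step, map_add, map_mul, aeval_C, add_mul, mul_assoc (algebraMap _ _ _), h.D_F, mul_zero,
      add_zero, h.F_e, add_sub_cancel_right, mul_assoc]
  · apply h.ext_e
    intro i
    rw [mul_assoc, h.K_e, mul_assoc, ze, mv h.cas_K, h.K_e, mul_smul_comm, mul_smul_comm, ze]
  · apply h.ext_e
    intro i
    rw [mul_assoc, h.L_e, mul_assoc, ze, mv h.cas_L, h.L_e, mul_smul_comm, mul_smul_comm, ze]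

lemma uniq (hfaith : ∀ (j : ℤ) (f : ℂ[X]), aeval (cas q E F K L) f * ej p q K j = 0 →
    Psi p q j ∣ f) (j : ℤ) {f g : ℂ[X]} (hf : f ∈ degreeLT ℂ p) (hg : g ∈ degreeLT ℂ p)
    (hfg : aeval (cas q E F K L) f * ej p q K j = aeval (cas q E F K L) g * ej p q K j) :
    f = g := by
  rw [← sub_eq_zero]
  apply eq_zero_of_dvd_of_degree_lt (hfaith j (f - g) _)
  · rw [Psi_deg]
    exact mem_degreeLT.1 (Submodule.sub_mem _ hf hg)
  · rw [map_sub, sub_mul, hfg, sub_self]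

lemma Phi_inj (h : Rl p q E F K L)
    (hfaith : ∀ (j : ℤ) (f : ℂ[X]), aeval (cas q E F K L) f * ej p q K j = 0 →
    Psi p q j ∣ f) : Function.Injective (Phi p q E F K L) := by
  rw [injective_iff_map_eq_zero]
  intro v hv
  have hz : ∀ j : ℕ, fL p q j v = 0 := by
    intro j
    apply uniq hfaith j (fL_mem h.hp j v) (Submodule.zero_mem _)
    rw [← Phi_e h, hv, map_zero, zero_mul]
  have h0 := hz 0
  have h1 := hz 1
  rw [fL_zero] at h0
  rw [fL_one] at h1
  refine Prod.ext (Subtype.ext h0) (Prod.ext (Subtype.ext h1) (funext fun i => ?_))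
  have h2 := fL_step (q := q) (i : ℕ) v
  rw [hz, hz, zero_add, atL_nat] at h2
  have := mul_eq_zero.1 h2.symm
  rcases this with h3 | h3
  · exact C_eq_zero.1 h3
  · exact absurd h3 (Dp_monic _).ne_zero

lemma Phi_surj (h : Rl p q E F K L) (hgen : Algebra.adjoin ℂ {E, F, K, L} = ⊤)
    (hfaith : ∀ (j : ℤ) (f : ℂ[X]), aeval (cas q E F K L) f * ej p q K j = 0 →
    Psi p q j ∣ f) (z : A) (hz : z ∈ Subalgebra.center ℂ A) : ∃ v, Phi p q E F K L v = z := by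
  have hp := h.hp
  have hq := h.hq
  rw [Subalgebra.mem_center_iff] at hz
  have ex1 : ∀ j : ℤ, ∃ f : ℂ[X], f ∈ degreeLT ℂ p ∧
      z * ej p q K j = aeval (cas q E F K L) f * ej p q K j := by
    intro j
    obtain ⟨g, hg⟩ := h.corner hgen j z
    refine ⟨g %ₘ Psi p q j, ?_, ?_⟩
    · rw [mem_degreeLT, ← Psi_deg (p := p) (q := q) j]
      exact degree_modByMonic_lt _ (Psi_monic j)
    · rw [← mul_assoc, hz, mul_assoc, h.e_idem] at hg
      rw [hg]
      conv_lhs => rw [← modByMonic_add_div g (Psi p q j)]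
      rw [mul_comm (Psi p q j), map_add, map_mul, add_mul, mul_assoc, h.Psi_e, mul_zero, add_zero]
  choose f hfd hf using ex1
  have fper : ∀ j : ℤ, f (j + 2 * p) = f j := by
    intro j
    apply uniq hfaith j (hfd _) (hfd _)
    rw [← hf, ← h.e_per j, ← hf]
  have ex2 : ∀ j : ℤ, ∃ a : ℂ, f (j + 2) - f j = C a * Dp p q j := by
    intro j
    have e1 : aeval (cas q E F K L) (f (j + 2) - f j) * (E * ej p q K j) = 0 := by
      rw [map_sub, sub_mul, sub_eq_zero]
      rw [← mv h.cas_E (f j), ← hf, ← mul_assoc E, hz, h.E_e, ← mul_assoc, ← hf, mul_assoc,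
        ← h.E_e, ← mul_assoc]
    have e2 : aeval (cas q E F K L) ((f (j + 2) - f j) * (X - C (cc q j))) * ej p q K j = 0 := by
      rw [map_mul, mul_assoc, ← h.FE_e, mul_assoc, ← mv h.cas_F, e1, mul_zero]
    have e3 := hfaith j _ e2
    rw [Psi_eq hp, mul_comm (f (j + 2) - f j)] at e3
    have e4 := (mul_dvd_mul_iff_left (X_sub_C_ne_zero (cc q j))).1 e3
    obtain ⟨g, hg⟩ := e4
    have hdeg : (f (j + 2) - f j).degree < (p : WithBot ℕ) :=
      mem_degreeLT.1 (Submodule.sub_mem _ (hfd _) (hfd _))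
    by_cases hg0 : g = 0
    · exact ⟨0, by rw [hg, hg0]; simp⟩
    · have hne : Dp p q j * g ≠ 0 := mul_ne_zero (Dp_monic j).ne_zero hg0
      rw [hg, degree_eq_natDegree hne, natDegree_mul (Dp_monic j).ne_zero hg0, Dp_natDeg] at hdeg
      have hlt : p - 1 + g.natDegree < p := by exact_mod_cast hdeg
      have : g = C (g.coeff 0) := eq_C_of_natDegree_eq_zero (by omega)
      exact ⟨g.coeff 0, by rw [hg, ← this, mul_comm]⟩
  choose a ha using ex2
  have aper : ∀ j m : ℤ, a (j + 2 * p * m) = a j := by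
    apply per_mul
    intro j
    have e1 := ha (j + 2 * p)
    rw [show j + 2 * (p : ℤ) + 2 = (j + 2) + 2 * p by ring, fper, fper, ha, Dp_per hp hq] at e1
    exact (C_injective (mul_right_cancel₀ (Dp_monic j).ne_zero e1)).symm
  have aodd : ∀ j, a j + a (-2 - j) = 0 := by
    intro j
    apply odd_of_sum hp hq a aper
    have e1 : ∀ i ∈ range p, C (a (j + 2 * (i : ℤ))) * Dp p q (j + 2 * (i : ℤ))
        = (fun i : ℕ => f (j + 2 * (i : ℤ))) (i + 1) - (fun i : ℕ => f (j + 2 * (i : ℤ))) i := by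
      intro i _
      rw [← ha]
      simp only
      congr 2
      push_cast; ring
    rw [sum_congr rfl e1, sum_range_sub (fun i : ℕ => f (j + 2 * (i : ℤ)))]
    simp only [Nat.cast_zero, mul_zero, add_zero]
    rw [fper, sub_self]
  refine ⟨(⟨f 0, hfd 0⟩, ⟨f 1, hfd 1⟩, fun i => a ((i : ℕ) : ℤ)), ?_⟩
  set v : VV p := (⟨f 0, hfd 0⟩, ⟨f 1, hfd 1⟩, fun i => a ((i : ℕ) : ℤ)) with hv
  have key : ∀ j : ℕ, fL p q j v = f j := by
    intro j
    induction j using Nat.twoStepInduction with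
    | zero => rw [fL_zero]; rfl
    | one => rw [fL_one]; rfl
    | more n ih _ =>
      have e1 : atL p n v.2.2 = a n := atL_of_odd hp a aper aodd n
      rw [fL_step, ih, e1, ← ha]
      push_cast
      ring
  apply h.ext_e
  intro j
  rw [Phi_e h, key, ← hf]

theorem finrank_center (h : Rl p q E F K L) (hgen : Algebra.adjoin ℂ {E, F, K, L} = ⊤)
    (hfaith : ∀ (j : ℤ) (f : ℂ[X]), aeval (cas q E F K L) f * ej p q K j = 0 →
    Psi p q j ∣ f) : Module.finrank ℂ (Subalgebra.center ℂ A) = 3 * p - 1 := by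
  have hp := h.hp
  have hr : LinearMap.range (Phi p q E F K L) = Subalgebra.toSubmodule (Subalgebra.center ℂ A) := by
    ext z
    constructor
    · rintro ⟨v, rfl⟩
      exact Phi_mem h hgen v
    · intro hz
      exact Phi_surj h hgen hfaith z hz
  have e1 := LinearMap.finrank_range_of_inj (Phi_inj h hfaith)
  rw [hr] at e1
  have e2 : Module.finrank ℂ (degreeLT ℂ p) = p := by
    rw [(degreeLTEquiv ℂ p).finrank_eq, Module.finrank_fin_fun]
  have : Module.Finite ℂ (degreeLT ℂ p) := Module.Finite.equiv (degreeLTEquiv ℂ p).symm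
  rw [Module.finrank_prod, Module.finrank_prod, e2, Module.finrank_fin_fun] at e1
  change Module.finrank ℂ (Subalgebra.toSubmodule (Subalgebra.center ℂ A)) = _
  omega

end Count
end LH

namespace LH
open Polynomial LogHennings

section Inst

lemma qq_prim (p : ℕ) (hp : 2 ≤ p) : IsPrimitiveRoot (qq p) (2 * p) := by
  have h := Complex.isPrimitiveRoot_exp (2 * p) (by omega)
  have e : qq p = Complex.exp (2 * Real.pi * Complex.I / ((2 * p : ℕ) : ℂ)) := by
    unfold qq
    congr 1
    push_cast
    rw [mul_assoc, mul_div_mul_left _ _ (two_ne_zero)]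
  rw [e]; exact h

lemma uq_rl (p : ℕ) (hp : 2 ≤ p) : Rl p (qq p) (UE p) (UF p) (UK p) (UKinv p) := by
  have hq := qq_prim p hp
  have h0 := q_ne hp hq
  have KL : UK p * UKinv p = 1 := by
    have := RingQuot.mkAlgHom_rel ℂ (URel.KKinv (p := p))
    rwa [map_mul, map_one] at this
  have LK : UKinv p * UK p = 1 := by
    have := RingQuot.mkAlgHom_rel ℂ (URel.KinvK (p := p))
    rwa [map_mul, map_one] at this
  have KE : UK p * UE p * UKinv p = qq p ^ 2 • UE p := by
    have := RingQuot.mkAlgHom_rel ℂ (URel.KE (p := p))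
    rwa [map_mul, map_mul, map_smul] at this
  have KF : UK p * UF p * UKinv p = (qq p ^ 2)⁻¹ • UF p := by
    have := RingQuot.mkAlgHom_rel ℂ (URel.KF (p := p))
    rwa [map_mul, map_mul, map_smul] at this
  refine ⟨hp, hq, ?_, ?_, ?_, KL, LK, ?_, ?_, ?_⟩
  · have := RingQuot.mkAlgHom_rel ℂ (URel.Epow (p := p))
    rwa [map_pow, map_zero] at this
  · have := RingQuot.mkAlgHom_rel ℂ (URel.Fpow (p := p))
    rwa [map_pow, map_zero] at this
  · have := RingQuot.mkAlgHom_rel ℂ (URel.Kpow (p := p))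
    rwa [map_pow, map_one] at this
  · have := congrArg (fun x => x * UK p) KE
    simp only [mul_assoc, LK, mul_one, smul_mul_assoc] at this
    exact this
  · have := congrArg (fun x => qq p ^ 2 • (x * UK p)) KF
    simp only [mul_assoc, LK, mul_one, smul_mul_assoc, smul_smul] at this
    rw [mul_inv_cancel₀ (pow_ne_zero 2 h0), one_smul] at this
    exact this.symm
  · have := RingQuot.mkAlgHom_rel ℂ (URel.EF (p := p))
    rwa [map_sub, map_mul, map_mul, map_smul, map_sub] at this

lemma uq_gen (p : ℕ) : Algebra.adjoin ℂ {UE p, UF p, UK p, UKinv p} = ⊤ := by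
  have h1 := FreeAlgebra.adjoin_range_ι ℂ UGen
  have h2 := congrArg (Subalgebra.map (RingQuot.mkAlgHom ℂ (URel p))) h1
  rw [AlgHom.map_adjoin, Algebra.map_top,
    (AlgHom.range_eq_top _).2 (RingQuot.mkAlgHom_surjective ℂ (URel p))] at h2
  rw [eq_top_iff, ← h2]
  apply Algebra.adjoin_mono
  rintro _ ⟨_, ⟨g, rfl⟩, rfl⟩
  cases g
  · left; rfl
  · right; left; rfl
  · right; right; left; rfl
  · right; right; right; rfl

lemma lift_exists {p : ℕ} {B : Type*} [Ring B] [Algebra ℂ B] {E F K L : B}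
    (h : Rl p (qq p) E F K L) :
    ∃ ρ : Uq p →ₐ[ℂ] B, ρ (UE p) = E ∧ ρ (UF p) = F ∧ ρ (UK p) = K ∧ ρ (UKinv p) = L := by
  let g : UGen → B := fun x => match x with
    | UGen.E => E
    | UGen.F => F
    | UGen.K => K
    | UGen.Kinv => L
  let φ : FU →ₐ[ℂ] B := FreeAlgebra.lift ℂ g
  have hE : φ fE = E := FreeAlgebra.lift_ι_apply g UGen.E
  have hF : φ fF = F := FreeAlgebra.lift_ι_apply g UGen.F
  have hK : φ fK = K := FreeAlgebra.lift_ι_apply g UGen.K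
  have hL : φ fKinv = L := FreeAlgebra.lift_ι_apply g UGen.Kinv
  have hrel : ∀ ⦃x y : FU⦄, URel p x y → φ x = φ y := by
    intro x y hxy
    cases hxy with
    | Epow => rw [map_pow, hE, h.Ep, map_zero]
    | Fpow => rw [map_pow, hF, h.Fp, map_zero]
    | Kpow => rw [map_pow, hK, h.Kp, map_one]
    | KKinv => rw [map_mul, hK, hL, h.KL, map_one]
    | KinvK => rw [map_mul, hK, hL, h.LK, map_one]
    | KE => rw [map_mul, map_mul, map_smul, hE, hK, hL, h.KE, smul_mul_assoc, mul_assoc, h.KL,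
        mul_one]
    | KF =>
      have e1 : K * F = (qq p ^ 2)⁻¹ • (F * K) := by
        rw [h.FK, smul_smul, inv_mul_cancel₀ (pow_ne_zero 2 h.q0), one_smul]
      rw [map_mul, map_mul, map_smul, hF, hK, hL, e1, smul_mul_assoc, mul_assoc, h.KL, mul_one]
    | EF => rw [map_sub, map_mul, map_mul, map_smul, map_sub, hE, hF, hK, hL, h.EF]
  refine ⟨RingQuot.liftAlgHom ℂ ⟨φ, hrel⟩, ?_, ?_, ?_, ?_⟩
  · exact (RingQuot.liftAlgHom_mkAlgHom_apply ℂ φ hrel fE).trans hE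
  · exact (RingQuot.liftAlgHom_mkAlgHom_apply ℂ φ hrel fF).trans hF
  · exact (RingQuot.liftAlgHom_mkAlgHom_apply ℂ φ hrel fK).trans hK
  · exact (RingQuot.liftAlgHom_mkAlgHom_apply ℂ φ hrel fKinv).trans hL

lemma map_ej {p : ℕ} {q : ℂ} {A B : Type*} [Ring A] [Algebra ℂ A] [Ring B] [Algebra ℂ B]
    (ρ : A →ₐ[ℂ] B) (K : A) (j : ℤ) : ρ (ej p q K j) = ej p q (ρ K) j := by
  unfold ej
  rw [map_smul, map_sum]
  congr 1
  apply sum_congr rfl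
  intro k _
  rw [map_smul, map_pow]

lemma map_cas {q : ℂ} {A B : Type*} [Ring A] [Algebra ℂ A] [Ring B] [Algebra ℂ B]
    (ρ : A →ₐ[ℂ] B) (E F K L : A) : ρ (cas q E F K L) = cas q (ρ E) (ρ F) (ρ K) (ρ L) := by
  unfold cas
  rw [map_add, map_mul, map_smul, map_add, map_smul, map_smul]

lemma map_zero_gen {p : ℕ} {q : ℂ} {A B : Type*} [Ring A] [Algebra ℂ A] [Ring B] [Algebra ℂ B]
    (ρ : A →ₐ[ℂ] B) {E F K L : A} {Ea Fa Ka La : B} (hE : ρ E = Ea) (hF : ρ F = Fa)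
    (hK : ρ K = Ka) (hL : ρ L = La) (j : ℤ) (f : ℂ[X])
    (hf : aeval (cas q E F K L) f * ej p q K j = 0) :
    aeval (cas q Ea Fa Ka La) f * ej p q Ka j = 0 := by
  have := congrArg ρ hf
  rw [map_mul, map_zero, map_ej, ← Polynomial.aeval_algHom_apply, map_cas, hE, hF, hK, hL] at this
  exact this

lemma uq_faith (p : ℕ) (hp : 2 ≤ p) (j : ℤ) (f : ℂ[X])
    (hf : aeval (cas (qq p) (UE p) (UF p) (UK p) (UKinv p)) f * ej p (qq p) (UK p) j = 0) :
    Psi p (qq p) j ∣ f := by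
  have hq := qq_prim p hp
  obtain ⟨ρ, hE, hF, hK, hL⟩ := lift_exists (model_rl j hp hq)
  apply model_faithful j hp hq
  exact map_zero_gen (p := p) (q := qq p) (A := Uq p) (B := Module.End ℂ (MM p (qq p) j))
    (E := UE p) (F := UF p) (K := UK p) (L := UKinv p) ρ hE hF hK hL j f hf

end Inst
end LH

open LogHennings in
/-- The center of `U` has dimension `3p - 1`. -/
theorem center_dimension (p : ℕ) (hp : 2 ≤ p) :
    Module.finrank ℂ (Subalgebra.center ℂ (Uq p)) = 3 * p - 1 := by
  exact LH.finrank_center (LH.uq_rl p hp) (LH.uq_gen p) (LH.uq_faith p hp)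
end
end

section
/- The 0-th Hochschild homology HH₀(U) = U/[U,U] of the restricted quantum group U has ℂ-dimension 3p − 1, where [U,U] is the ℂ-linear span of all commutators xy − yx with x, y ∈ U. -/
open scoped TensorProduct
open Finset

noncomputable section

namespace LogHennings

lemma qq_prim (p : ℕ) (hp : 2 ≤ p) : IsPrimitiveRoot (qq p) (2 * p) := by
  have h := Complex.isPrimitiveRoot_exp (2 * p) (by omega)
  have e : qq p = Complex.exp (2 * Real.pi * Complex.I / ((2 * p : ℕ) : ℂ)) := by
    unfold qq
    congr 1
    have : (p : ℂ) ≠ 0 := by exact_mod_cast (by omega : p ≠ 0)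
    push_cast
    field_simp
  rw [e]; exact h

lemma qq_ne (p : ℕ) : qq p ≠ 0 := Complex.exp_ne_zero _

lemma qz_one_iff (p : ℕ) (hp : 2 ≤ p) (m : ℤ) : (qq p) ^ m = 1 ↔ (2 * (p : ℤ)) ∣ m := by
  have := (qq_prim p hp).zpow_eq_one_iff_dvd m
  simpa using this

lemma qz_eq_iff (p : ℕ) (hp : 2 ≤ p) (m n : ℤ) :
    (qq p) ^ m = (qq p) ^ n ↔ (2 * (p : ℤ)) ∣ m - n := by
  rw [← qz_one_iff p hp, zpow_sub₀ (qq_ne p), div_eq_one_iff_eq (zpow_ne_zero _ (qq_ne p))]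

lemma qden_ne (p : ℕ) (hp : 2 ≤ p) : qq p - (qq p)⁻¹ ≠ 0 := by
  intro h
  have h2 : (qq p) ^ (2 : ℤ) = 1 := by
    have h3 : qq p = (qq p)⁻¹ := sub_eq_zero.mp h
    have h0 := qq_ne p
    field_simp at h3
    exact_mod_cast h3
  rw [qz_one_iff p hp] at h2
  have := Int.le_of_dvd (by norm_num) h2
  omega

/-- Value of the Casimir. -/
def cc (p : ℕ) (m : ℤ) : ℂ := ((qq p) ^ m + (qq p) ^ (-m)) / ((qq p - (qq p)⁻¹) ^ 2)

lemma cc_neg (p : ℕ) (m : ℤ) : cc p (-m) = cc p m := by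
  unfold cc; rw [neg_neg, add_comm]

lemma cc_eq_iff (p : ℕ) (hp : 2 ≤ p) (m n : ℤ) :
    cc p m = cc p n ↔ (2 * (p : ℤ)) ∣ m - n ∨ (2 * (p : ℤ)) ∣ m + n := by
  have hd : (qq p - (qq p)⁻¹) ^ 2 ≠ 0 := pow_ne_zero _ (qden_ne p hp)
  have hm := zpow_ne_zero m (qq_ne p)
  have hn := zpow_ne_zero n (qq_ne p)
  rw [← qz_eq_iff p hp, show m + n = m - (-n) by ring, ← qz_eq_iff p hp]
  unfold cc
  rw [div_left_inj' hd]
  simp only [zpow_neg]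
  generalize (qq p) ^ m = x at *
  generalize (qq p) ^ n = y at *
  have key : x + x⁻¹ - (y + y⁻¹) = (x - y) * (x - y⁻¹) * x⁻¹ := by
    field_simp; ring
  rw [← sub_eq_zero, key]
  simp [hm, sub_eq_zero]

lemma cc_congr (p : ℕ) (hp : 2 ≤ p) (m n : ℤ) (h : (2 * (p : ℤ)) ∣ m - n) : cc p m = cc p n :=
  (cc_eq_iff p hp m n).2 (Or.inl h)

lemma cc_diff (p : ℕ) (hp : 2 ≤ p) (w : ℤ) :
    cc p (w + 1) - cc p (w - 1) =
      (qq p - (qq p)⁻¹)⁻¹ * ((qq p) ^ w - ((qq p) ^ w)⁻¹) := by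
  have hd : qq p - (qq p)⁻¹ ≠ 0 := qden_ne p hp
  have h0 := qq_ne p
  have hm := zpow_ne_zero w (qq_ne p)
  unfold cc
  rw [show -(w+1) = -w - 1 by ring, show -(w-1) = -w + 1 by ring]
  simp only [zpow_add₀ h0, zpow_sub₀ h0, zpow_neg, zpow_one]
  generalize (qq p) ^ w = x at *
  have : x * qq p + x⁻¹ / qq p - (x / qq p + x⁻¹ * qq p) = (qq p - (qq p)⁻¹) * (x - x⁻¹) := by
    field_simp; ring
  rw [← sub_div, this]
  field_simp

/-- orthogonality -/
lemma orth (p : ℕ) (hp : 2 ≤ p) (m : ℤ) :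
    ((2 * p : ℂ))⁻¹ * ∑ l ∈ range (2 * p), ((qq p) ^ m) ^ l =
      if (2 * (p : ℤ)) ∣ m then 1 else 0 := by
  have hp0 : (p : ℂ) ≠ 0 := by exact_mod_cast (by omega : p ≠ 0)
  split_ifs with h
  · rw [(qz_one_iff p hp m).2 h]; simp [hp0]; field_simp
  · have h1 : (qq p) ^ m ≠ 1 := fun h' => h ((qz_one_iff p hp m).1 h')
    rw [geom_sum_eq h1, ← zpow_natCast, ← zpow_mul,
      (qz_one_iff p hp _).2 (by push_cast; exact Dvd.intro_left m rfl)]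
    simp

section rels
variable (p : ℕ)

lemma U_EF : UE p * UF p - UF p * UE p = (qq p - (qq p)⁻¹)⁻¹ • (UK p - UKinv p) := by
  have := RingQuot.mkAlgHom_rel ℂ (URel.EF (p := p))
  simpa [UE, UF, UK, UKinv] using this

lemma U_Epow : UE p ^ p = 0 := by
  have := RingQuot.mkAlgHom_rel ℂ (URel.Epow (p := p))
  simpa [UE, UF, UK, UKinv] using this

lemma U_Fpow : UF p ^ p = 0 := by
  have := RingQuot.mkAlgHom_rel ℂ (URel.Fpow (p := p))
  simpa [UE, UF, UK, UKinv] using this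

lemma U_Kpow : UK p ^ (2 * p) = 1 := by
  have := RingQuot.mkAlgHom_rel ℂ (URel.Kpow (p := p))
  simpa only [UK, map_pow, map_one] using this

lemma U_KKinv : UK p * UKinv p = 1 := by
  have := RingQuot.mkAlgHom_rel ℂ (URel.KKinv (p := p))
  simpa [UE, UF, UK, UKinv] using this

lemma U_KinvK : UKinv p * UK p = 1 := by
  have := RingQuot.mkAlgHom_rel ℂ (URel.KinvK (p := p))
  simpa [UE, UF, UK, UKinv] using this

lemma U_KE : UK p * UE p = (qq p) ^ 2 • (UE p * UK p) := by
  have := RingQuot.mkAlgHom_rel ℂ (URel.KE (p := p))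
  have h : UK p * UE p * UKinv p = (qq p) ^ 2 • UE p := by
    simpa [UE, UF, UK, UKinv] using this
  calc UK p * UE p = UK p * UE p * UKinv p * UK p := by
        rw [mul_assoc _ (UKinv p), U_KinvK, mul_one]
    _ = _ := by rw [h, smul_mul_assoc]

lemma U_KF : UK p * UF p = ((qq p) ^ 2)⁻¹ • (UF p * UK p) := by
  have := RingQuot.mkAlgHom_rel ℂ (URel.KF (p := p))
  have h : UK p * UF p * UKinv p = ((qq p) ^ 2)⁻¹ • UF p := by
    simpa [UE, UF, UK, UKinv] using this
  calc UK p * UF p = UK p * UF p * UKinv p * UK p := by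
        rw [mul_assoc _ (UKinv p), U_KinvK, mul_one]
    _ = _ := by rw [h, smul_mul_assoc]

lemma U_EK : UE p * UK p = ((qq p) ^ 2)⁻¹ • (UK p * UE p) := by
  rw [U_KE, smul_smul, inv_mul_cancel₀ (pow_ne_zero _ (qq_ne p)), one_smul]

lemma U_FK : UF p * UK p = ((qq p) ^ 2) • (UK p * UF p) := by
  rw [U_KF, smul_smul, mul_inv_cancel₀ (pow_ne_zero _ (qq_ne p)), one_smul]

lemma U_KinvE : UKinv p * UE p = ((qq p) ^ 2)⁻¹ • (UE p * UKinv p) := by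
  calc UKinv p * UE p = UKinv p * (UE p * UK p) * UKinv p := by
        rw [mul_assoc, mul_assoc, U_KKinv, mul_one]
    _ = _ := by
      rw [U_EK, mul_smul_comm, smul_mul_assoc, ← mul_assoc, U_KinvK, one_mul]

lemma U_KinvF : UKinv p * UF p = ((qq p) ^ 2) • (UF p * UKinv p) := by
  calc UKinv p * UF p = UKinv p * (UF p * UK p) * UKinv p := by
        rw [mul_assoc, mul_assoc, U_KKinv, mul_one]
    _ = _ := by
      rw [U_FK, mul_smul_comm, smul_mul_assoc, ← mul_assoc, U_KinvK, one_mul]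

lemma U_Kinv_eq (hp : 2 ≤ p) : UKinv p = UK p ^ (2 * p - 1) := by
  calc UKinv p = UKinv p * UK p ^ (2 * p) := by rw [U_Kpow, mul_one]
    _ = UKinv p * (UK p * UK p ^ (2 * p - 1)) := by
        rw [← pow_succ', show 2 * p - 1 + 1 = 2 * p by omega]
    _ = _ := by rw [← mul_assoc, U_KinvK, one_mul]

/-- Induction principle: a left ideal containing one is everything. -/
lemma U_top (S : Submodule ℂ (Uq p)) (h1 : (1 : Uq p) ∈ S)
    (hE : ∀ x ∈ S, UE p * x ∈ S) (hF : ∀ x ∈ S, UF p * x ∈ S) (hK : ∀ x ∈ S, UK p * x ∈ S)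
    (hKi : ∀ x ∈ S, UKinv p * x ∈ S) : ∀ x, x ∈ S := by
  have key : ∀ y : FU, ∀ x ∈ S, RingQuot.mkAlgHom ℂ (URel p) y * x ∈ S := by
    intro y
    induction y using FreeAlgebra.induction with
    | grade0 r =>
      intro x hx
      rw [AlgHom.commutes, ← Algebra.smul_def]
      exact S.smul_mem _ hx
    | grade1 g =>
      cases g
      · exact hE
      · exact hF
      · exact hK
      · exact hKi
    | mul a b ha hb =>
      intro x hx
      rw [map_mul, mul_assoc]
      exact ha _ (hb _ hx)
    | add a b ha hb =>
      intro x hx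
      rw [map_add, add_mul]
      exact S.add_mem (ha _ hx) (hb _ hx)
  intro x
  obtain ⟨y, rfl⟩ := RingQuot.mkAlgHom_surjective ℂ (URel p) x
  simpa using key y 1 h1

/-- Casimir element. -/
def Cas : Uq p := UE p * UF p +
  ((qq p - (qq p)⁻¹) ^ 2)⁻¹ • ((qq p)⁻¹ • UK p + qq p • UKinv p)

lemma Cas_alt (hp : 2 ≤ p) : Cas p = UF p * UE p +
  ((qq p - (qq p)⁻¹) ^ 2)⁻¹ • (qq p • UK p + (qq p)⁻¹ • UKinv p) := by
  have h := U_EF p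
  rw [sub_eq_iff_eq_add] at h
  unfold Cas
  rw [h]
  have hd := qden_ne p hp
  generalize hx : qq p - (qq p)⁻¹ = d at *
  have hx' : qq p = d + (qq p)⁻¹ := by rw [← hx]; ring
  generalize hy : (qq p)⁻¹ = y at *
  rw [hx']
  match_scalars <;> field_simp <;> ring

lemma Cas_E (hp : 2 ≤ p) : Cas p * UE p = UE p * Cas p := by
  have h0 := qq_ne p
  conv_rhs => rw [Cas_alt p hp]
  unfold Cas
  simp only [add_mul, mul_add, mul_smul_comm, smul_mul_assoc, smul_add, U_KE, U_KinvE, ← mul_assoc]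
  match_scalars <;> field_simp

lemma Cas_F (hp : 2 ≤ p) : Cas p * UF p = UF p * Cas p := by
  have h0 := qq_ne p
  conv_lhs => rw [Cas_alt p hp]
  unfold Cas
  simp only [add_mul, mul_add, mul_smul_comm, smul_mul_assoc, smul_add, U_KF, U_KinvF, ← mul_assoc]
  match_scalars <;> field_simp

lemma Cas_K : Cas p * UK p = UK p * Cas p := by
  have h0 := qq_ne p
  have h : UK p * (UE p * UF p) = UE p * UF p * UK p := by
    rw [← mul_assoc, U_KE, smul_mul_assoc, mul_assoc, U_KF, mul_smul_comm, smul_smul,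
      mul_inv_cancel₀ (pow_ne_zero _ h0), one_smul, mul_assoc]
  unfold Cas
  simp only [add_mul, mul_add, mul_smul_comm, smul_mul_assoc, smul_add, h, U_KKinv, U_KinvK]

/-- weight idempotent -/
def idm (m : ℤ) : Uq p :=
  ((2 * p : ℂ))⁻¹ • ∑ l ∈ range (2 * p), ((qq p) ^ (-m)) ^ l • UK p ^ l

lemma idm_congr (hp : 2 ≤ p) (m n : ℤ) (h : (2 * (p : ℤ)) ∣ m - n) : idm p m = idm p n := by
  unfold idm
  rw [(qz_eq_iff p hp (-m) (-n)).2 (by rw [show -m - -n = -(m - n) by ring]; exact h.neg_right)]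

lemma K_idm (hp : 2 ≤ p) (m : ℤ) : UK p * idm p m = (qq p) ^ m • idm p m := by
  have h0 := zpow_ne_zero m (qq_ne p)
  unfold idm
  rw [mul_smul_comm, smul_comm]
  congr 1
  rw [Finset.mul_sum]
  have e : ∀ l, UK p * ((qq p ^ (-m)) ^ l • UK p ^ l) =
      (qq p) ^ m • ((qq p ^ (-m)) ^ (l + 1) • UK p ^ (l + 1)) := by
    intro l
    rw [mul_smul_comm, ← pow_succ', smul_smul]
    congr 1
    rw [pow_succ, zpow_neg]; field_simp
  simp_rw [e]
  rw [← Finset.smul_sum]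
  congr 1
  have h1 := Finset.sum_range_succ (fun l => (qq p ^ (-m)) ^ l • UK p ^ l) (2 * p)
  have h2 := Finset.sum_range_succ' (fun l => (qq p ^ (-m)) ^ l • UK p ^ l) (2 * p)
  rw [h1] at h2
  have h3 : (qq p ^ (-m)) ^ (2 * p) = 1 := by
    rw [← zpow_natCast, ← zpow_mul, qz_one_iff p hp]; push_cast; exact Dvd.intro_left _ rfl
  rw [U_Kpow, h3] at h2
  simp only [pow_zero] at h2
  exact (add_right_cancel h2).symm

lemma Kinv_idm (hp : 2 ≤ p) (m : ℤ) : UKinv p * idm p m = (qq p) ^ (-m) • idm p m := by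
  have h0 := zpow_ne_zero m (qq_ne p)
  have h : UKinv p * (UK p * idm p m) = idm p m := by rw [← mul_assoc, U_KinvK, one_mul]
  rw [K_idm p hp, mul_smul_comm] at h
  rw [← h, smul_smul, zpow_neg, inv_mul_cancel₀ h0, one_smul, h]

lemma K_pow_idm (hp : 2 ≤ p) (m : ℤ) (l : ℕ) :
    UK p ^ l * idm p m = ((qq p) ^ m) ^ l • idm p m := by
  induction l with
  | zero => simp
  | succ l ih => rw [pow_succ, mul_assoc, K_idm p hp, mul_smul_comm, ih, smul_smul, ← pow_succ']

lemma sum_idm (hp : 2 ≤ p) : ∑ m ∈ range (2 * p), idm p m = 1 := by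
  unfold idm
  simp_rw [Finset.smul_sum]
  rw [Finset.sum_comm]
  simp_rw [smul_smul, ← Finset.sum_smul, ← Finset.mul_sum]
  have : ∀ l ∈ range (2 * p), (((2 * p : ℂ))⁻¹ * ∑ m ∈ range (2 * p), (qq p ^ (-(m : ℤ))) ^ l) • UK p ^ l
      = if l = 0 then 1 else 0 := by
    intro l hl
    have e : ∀ m : ℕ, (qq p ^ (-(m : ℤ))) ^ l = (qq p ^ (-(l : ℤ))) ^ m := by
      intro m
      simp only [← zpow_natCast, ← zpow_mul]
      congr 1; ring
    simp_rw [e]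
    rw [orth p hp]
    rw [Finset.mem_range] at hl
    by_cases h : l = 0
    · simp [h]
    · rw [if_neg, if_neg h, zero_smul]
      intro hd
      have := Int.le_of_dvd (by omega) (Int.dvd_neg.1 hd)
      omega
  rw [Finset.sum_congr rfl this]
  simp; omega

lemma K_pow_eq (hp : 2 ≤ p) (l : ℕ) :
    UK p ^ l = ∑ m ∈ range (2 * p), ((qq p) ^ (m : ℤ)) ^ l • idm p m := by
  calc UK p ^ l = UK p ^ l * ∑ m ∈ range (2 * p), idm p m := by rw [sum_idm p hp, mul_one]
    _ = _ := by rw [Finset.mul_sum]; simp_rw [K_pow_idm p hp]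

lemma E_Kpow (l : ℕ) : UE p * UK p ^ l = (((qq p) ^ 2)⁻¹) ^ l • (UK p ^ l * UE p) := by
  induction l with
  | zero => simp
  | succ l ih =>
    rw [pow_succ, ← mul_assoc, ih, smul_mul_assoc, mul_assoc, U_EK, mul_smul_comm, smul_smul,
      ← mul_assoc, ← pow_succ]

lemma F_Kpow (l : ℕ) : UF p * UK p ^ l = ((qq p) ^ 2) ^ l • (UK p ^ l * UF p) := by
  induction l with
  | zero => simp
  | succ l ih =>
    rw [pow_succ, ← mul_assoc, ih, smul_mul_assoc, mul_assoc, U_FK, mul_smul_comm, smul_smul,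
      ← mul_assoc, ← pow_succ]

lemma E_idm (m : ℤ) : UE p * idm p m = idm p (m + 2) * UE p := by
  unfold idm
  rw [mul_smul_comm, smul_mul_assoc, Finset.mul_sum, Finset.sum_mul]
  congr 1
  refine Finset.sum_congr rfl fun l _ => ?_
  rw [mul_smul_comm, E_Kpow, smul_smul, smul_mul_assoc]
  congr 1
  rw [← mul_pow, neg_add, zpow_add₀ (qq_ne p), zpow_neg _ 2]
  norm_cast

lemma F_idm (m : ℤ) : UF p * idm p m = idm p (m - 2) * UF p := by
  unfold idm
  rw [mul_smul_comm, smul_mul_assoc, Finset.mul_sum, Finset.sum_mul]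
  congr 1
  refine Finset.sum_congr rfl fun l _ => ?_
  rw [mul_smul_comm, F_Kpow, smul_smul, smul_mul_assoc]
  congr 1
  rw [← mul_pow, neg_sub, sub_eq_neg_add, zpow_add₀ (qq_ne p)]
  norm_cast

lemma Cas_idm (m : ℤ) : Cas p * idm p m = idm p m * Cas p := by
  have h : ∀ l : ℕ, Commute (Cas p) (UK p ^ l) := fun l => Commute.pow_right (Cas_K p) l
  unfold idm
  rw [mul_smul_comm, smul_mul_assoc, Finset.mul_sum, Finset.sum_mul]
  congr 1
  refine Finset.sum_congr rfl fun l _ => ?_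
  rw [mul_smul_comm, smul_mul_assoc, (h l).eq]

lemma EF_idm (hp : 2 ≤ p) (m : ℤ) :
    UE p * UF p * idm p m = Cas p * idm p m - cc p (m - 1) • idm p m := by
  have h0 := qq_ne p
  rw [eq_sub_iff_add_eq]
  unfold Cas cc
  rw [add_mul, smul_mul_assoc, add_mul, smul_mul_assoc, smul_mul_assoc, K_idm p hp, Kinv_idm p hp]
  congr 1
  rw [smul_smul, smul_smul, ← add_smul, smul_smul]
  congr 1
  rw [neg_sub, sub_eq_add_neg, sub_eq_add_neg, zpow_add₀ h0, zpow_add₀ h0, zpow_one, zpow_neg_one,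
    div_eq_mul_inv]
  ring

lemma FE_idm (hp : 2 ≤ p) (m : ℤ) :
    UF p * UE p * idm p m = Cas p * idm p m - cc p (m + 1) • idm p m := by
  have h0 := qq_ne p
  rw [eq_sub_iff_add_eq, Cas_alt p hp]
  unfold cc
  rw [add_mul, smul_mul_assoc, add_mul, smul_mul_assoc, smul_mul_assoc, K_idm p hp, Kinv_idm p hp]
  congr 1
  rw [smul_smul, smul_smul, ← add_smul, smul_smul]
  congr 1
  rw [neg_add, zpow_add₀ h0, zpow_add₀ h0, zpow_one, zpow_neg_one, div_eq_mul_inv]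
  ring

end rels

end LogHennings

namespace LogHennings

section upper
variable (p : ℕ)

lemma comm_mem (x y : Uq p) : x * y - y * x ∈ commSpan p :=
  Submodule.subset_span ⟨x, y, rfl⟩

open Polynomial in
/-- class of `f(C) 1_m` in `HH₀`. -/
def hh (m : ℤ) : ℂ[X] →ₗ[ℂ] (Uq p ⧸ commSpan p) :=
  (commSpan p).mkQ ∘ₗ (LinearMap.mulRight ℂ (idm p m)) ∘ₗ (aeval (Cas p)).toLinearMap

open Polynomial in
lemma hh_apply (m : ℤ) (f : ℂ[X]) :
    hh p m f = (commSpan p).mkQ (aeval (Cas p) f * idm p m) := rfl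

lemma hh_congr (hp : 2 ≤ p) (m n : ℤ) (h : (2 * (p : ℤ)) ∣ m - n) : hh p m = hh p n := by
  refine LinearMap.ext fun f => ?_
  rw [hh_apply, hh_apply, idm_congr p hp m n h]

lemma poly_comm (x : Uq p) (h : Commute (Cas p) x) (f : Polynomial ℂ) :
    Commute (Polynomial.aeval (Cas p) f) x := by
  induction f using Polynomial.induction_on' with
  | add f g hf hg => rw [map_add]; exact hf.add_left hg
  | monomial n a =>
    rw [Polynomial.aeval_monomial]
    exact (Algebra.commute_algebraMap_left a x).mul_left (h.pow_left n)

open Polynomial in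
lemma hh_step (hp : 2 ≤ p) (m : ℤ) (f : ℂ[X]) :
    hh p m (f * (X - C (cc p (m - 1)))) = hh p (m - 2) (f * (X - C (cc p (m - 1)))) := by
  rw [hh_apply, hh_apply, ← sub_eq_zero, ← map_sub, Submodule.mkQ_apply,
    Submodule.Quotient.mk_eq_zero]
  have hE := poly_comm p _ (Cas_E p hp) f
  have hF := poly_comm p _ (Cas_F p hp) f
  have h1 : aeval (Cas p) (f * (X - C (cc p (m - 1)))) * idm p m =
      UE p * (UF p * (aeval (Cas p) f * idm p m)) := by
    rw [← mul_assoc, ← mul_assoc, ← (hE.mul_right hF).eq, mul_assoc, EF_idm p hp,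
      map_mul, mul_assoc]
    congr 1
    simp [sub_mul, Algebra.smul_def]
  have h2 : aeval (Cas p) (f * (X - C (cc p (m - 1)))) * idm p (m - 2) =
      (UF p * (aeval (Cas p) f * idm p m)) * UE p := by
    rw [mul_assoc (UF p), mul_assoc, show m = m - 2 + 2 by ring, ← E_idm, ← mul_assoc,
      ← mul_assoc, ← hF.eq, mul_assoc (aeval (Cas p) f), mul_assoc (aeval (Cas p) f),
      FE_idm p hp, map_mul, mul_assoc]
    congr 1
    rw [show m - 2 + 2 - 1 = m - 2 + 1 by ring, show m - 2 + 2 - 2 = m - 2 by ring]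
    simp [sub_mul, Algebra.smul_def]
  rw [h1, h2]
  exact comm_mem p _ _

/-- differences -/
def dd (m : ℤ) : Uq p ⧸ commSpan p := hh p m 1 - hh p (m - 2) 1

lemma dd_congr (hp : 2 ≤ p) (m n : ℤ) (h : (2 * (p : ℤ)) ∣ m - n) : dd p m = dd p n := by
  unfold dd
  rw [hh_congr p hp m n h, hh_congr p hp (m - 2) (n - 2) (by simpa using h)]

open Polynomial in
lemma hh_sub (hp : 2 ≤ p) (m : ℤ) (f : ℂ[X]) :
    hh p m f = hh p (m - 2) f + f.eval (cc p (m - 1)) • dd p m := by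
  have h := modByMonic_add_div f (X - C (cc p (m - 1)))
  rw [modByMonic_X_sub_C_eq_C_eval, mul_comm] at h
  have hs := hh_step p hp m (f /ₘ (X - C (cc p (m - 1))))
  set g := f /ₘ (X - C (cc p (m - 1))) * (X - C (cc p (m - 1)))
  have e : f = g + f.eval (cc p (m - 1)) • (1 : ℂ[X]) := by
    rw [← h, smul_eq_C_mul]
    simp [g, add_comm]
  unfold dd
  rw [smul_sub, ← map_smul, ← map_smul]
  calc hh p m f = hh p m (g + f.eval (cc p (m - 1)) • (1 : ℂ[X])) := by rw [← e]
    _ = hh p (m - 2) (g + f.eval (cc p (m - 1)) • (1 : ℂ[X])) +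
        (hh p m (eval (cc p (m - 1)) f • 1) - hh p (m - 2) (eval (cc p (m - 1)) f • 1)) := by
        rw [map_add, map_add, hs]; abel
    _ = _ := by rw [← e]

open Polynomial in
lemma hh_sum (hp : 2 ≤ p) (m : ℤ) (f : ℂ[X]) (n : ℕ) :
    hh p (m + 2 * n) f = hh p m f +
      ∑ i ∈ range n, f.eval (cc p (m + 2 * i + 1)) • dd p (m + 2 * i + 2) := by
  induction n with
  | zero => simp
  | succ n ih =>
    rw [Finset.sum_range_succ, ← add_assoc, ← ih, hh_sub p hp]
    congr 2
    · congr 1; push_cast; ring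
    · congr 2; push_cast; ring
    · congr 1; push_cast; ring

open Polynomial in
lemma F_pow_E_pow (hp : 2 ≤ p) (m : ℤ) (n : ℕ) :
    UF p ^ n * UE p ^ n * idm p m =
      aeval (Cas p) (∏ i ∈ range n, (X - C (cc p (m + 2 * i + 1)))) * idm p m := by
  induction n generalizing m with
  | zero => simp
  | succ n ih =>
    have hc : Commute (Cas p) (UF p) := Cas_F p hp
    rw [Finset.prod_range_succ', pow_succ' (UF p), pow_succ (UE p)]
    have : UF p * UF p ^ n * (UE p ^ n * UE p) * idm p m =
      UF p * (UF p ^ n * UE p ^ n * idm p (m + 2)) * UE p := by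
      rw [mul_assoc (UF p), mul_assoc (UF p), mul_assoc (UF p)]
      congr 1
      rw [mul_assoc (UF p ^ n * UE p ^ n), ← E_idm]
      simp only [mul_assoc]
    rw [this, ih, ← mul_assoc, ← (poly_comm p _ hc _).eq, mul_assoc, mul_assoc, ← E_idm,
      ← mul_assoc (UF p), FE_idm p hp, map_mul, mul_assoc]
    congr 1
    · congr 1
      refine Finset.prod_congr rfl fun i _ => ?_
      congr 3; push_cast; ring
    · simp [sub_mul, Algebra.smul_def]

/-- finite set of Casimir values -/
def cS : Finset ℂ := (range (2 * p)).image fun n : ℕ => cc p n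

lemma cc_mem_cS (hp : 2 ≤ p) (m : ℤ) : cc p m ∈ cS p := by
  unfold cS
  rw [Finset.mem_image]
  have hpos : (0 : ℤ) < 2 * p := by omega
  have h1 := Int.emod_nonneg m hpos.ne'
  have h2 := Int.emod_lt_of_pos m hpos
  refine ⟨(m % (2 * p)).toNat, ?_, ?_⟩
  · rw [Finset.mem_range]; omega
  · apply cc_congr p hp
    rw [Int.toNat_of_nonneg h1, ← dvd_neg, neg_sub]
    exact Int.dvd_self_sub_emod

open Polynomial in
/-- polynomial vanishing at all other Casimir values -/
def gp (x : ℂ) : ℂ[X] := ∏ b ∈ (cS p).erase x, (X - C b)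

open Polynomial in
lemma gp_self (x : ℂ) : (gp p x).eval x ≠ 0 := by
  unfold gp
  rw [eval_prod, Finset.prod_ne_zero_iff]
  intro b hb
  simp only [eval_sub, eval_X, eval_C]
  exact sub_ne_zero.2 (Finset.ne_of_mem_erase hb).symm

open Polynomial in
lemma gp_dvd (hp : 2 ≤ p) (x : ℂ) (m : ℤ) (h : cc p m ≠ x) : (X - C (cc p m)) ∣ gp p x :=
  Finset.dvd_prod_of_mem _ (Finset.mem_erase.2 ⟨h, cc_mem_cS p hp m⟩)

open Polynomial in
lemma gp_other (hp : 2 ≤ p) (x : ℂ) (m : ℤ) (h : cc p m ≠ x) : (gp p x).eval (cc p m) = 0 :=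
  dvd_iff_isRoot.1 (gp_dvd p hp x m h)

lemma dd_rel_aux (hp : 2 ≤ p) (a : ℤ) :
    ∑ i ∈ range p, (gp p (cc p a)).eval (cc p (-a - 1 + 2 * i + 1)) • dd p (-a - 1 + 2 * i + 2)
      = 0 := by
  have h := hh_sum p hp (-a - 1) (gp p (cc p a)) p
  rw [hh_congr p hp (-a - 1 + 2 * p) (-a - 1) (by simp)] at h
  simpa using h

lemma dd_rel (hp : 2 ≤ p) (a : ℕ) (h0 : 0 < a) (h1 : a < p) :
    dd p (1 - a) = - dd p (a + 1) := by
  have h := dd_rel_aux p hp a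
  rw [← Finset.sum_subset (s₁ := {0, a})] at h
  · rw [Finset.sum_pair (by omega)] at h
    rw [show (-(a : ℤ) - 1 + 2 * (0 : ℕ) + 1) = -a by push_cast; ring,
      show (-(a : ℤ) - 1 + 2 * (a : ℕ) + 1) = a by ring, cc_neg, ← smul_add,
      smul_eq_zero_iff_right (gp_self p _),
      show (-(a : ℤ) - 1 + 2 * (0 : ℕ) + 2) = 1 - a by push_cast; ring,
      show (-(a : ℤ) - 1 + 2 * (a : ℕ) + 2) = a + 1 by ring] at h
    exact eq_neg_of_add_eq_zero_left h
  · intro x hx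
    simp only [Finset.mem_insert, Finset.mem_singleton] at hx
    rw [Finset.mem_range]; omega
  · intro i hi hn
    simp only [Finset.mem_insert, Finset.mem_singleton, not_or] at hn
    rw [Finset.mem_range] at hi
    rw [gp_other p hp, zero_smul]
    rw [Ne, cc_eq_iff p hp]
    rintro (⟨t, ht⟩ | ⟨t, ht⟩)
    · have : ((i : ℤ) - a) = p * t := by linarith
      have : (p : ℤ) ∣ i - a := ⟨t, this⟩
      have := Int.eq_zero_of_abs_lt_dvd this (by rw [abs_lt]; omega)
      omega
    · have : (i : ℤ) = p * t := by linarith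
      have : (p : ℤ) ∣ i := ⟨t, this⟩
      have := Int.eq_zero_of_abs_lt_dvd this (by rw [abs_lt]; omega)
      omega

lemma dd_zero (hp : 2 ≤ p) (a : ℤ) (ha : (p : ℤ) ∣ a) : dd p (1 + a) = 0 := by
  have h := dd_rel_aux p hp a
  rw [Finset.sum_eq_single 0] at h
  · rw [show (-(a : ℤ) - 1 + 2 * (0 : ℕ) + 1) = -a by push_cast; ring, cc_neg,
      smul_eq_zero_iff_right (gp_self p _)] at h
    rw [← h]
    apply dd_congr p hp
    push_cast
    obtain ⟨t, rfl⟩ := ha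
    exact ⟨t, by ring⟩
  · intro i hi hn
    rw [Finset.mem_range] at hi
    rw [gp_other p hp, zero_smul]
    obtain ⟨s, rfl⟩ := ha
    rw [Ne, cc_eq_iff p hp]
    rintro (⟨t, ht⟩ | ⟨t, ht⟩)
    · have : (i : ℤ) = p * (t + s) := by linarith
      have : (p : ℤ) ∣ i := ⟨_, this⟩
      have := Int.eq_zero_of_abs_lt_dvd this (by rw [abs_lt]; omega)
      omega
    · have : (i : ℤ) = p * t := by linarith
      have : (p : ℤ) ∣ i := ⟨t, this⟩
      have := Int.eq_zero_of_abs_lt_dvd this (by rw [abs_lt]; omega)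
      omega
  · intro h; simp at h; omega

/-- the spanning family -/
def spanFam : Fin p ⊕ Fin p ⊕ Fin (p - 1) → Uq p ⧸ commSpan p
  | .inl k => hh p 0 (Polynomial.X ^ (k : ℕ))
  | .inr (.inl k) => hh p 1 (Polynomial.X ^ (k : ℕ))
  | .inr (.inr a) => dd p ((a : ℕ) + 1 + 1)

open Polynomial in
lemma hh_base (hp : 2 ≤ p) (m : ℤ) (N : Submodule ℂ (Uq p ⧸ commSpan p))
    (h : ∀ k < p, hh p m (X ^ k) ∈ N) (f : ℂ[X]) : hh p m f ∈ N := by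
  set P : ℂ[X] := ∏ i ∈ range p, (X - C (cc p (m + 2 * i + 1))) with hP
  have hm : P.Monic := monic_prod_of_monic _ _ fun i _ => monic_X_sub_C _
  have hdeg : P.natDegree = p := by
    rw [hP, natDegree_prod_of_monic _ _ fun i _ => monic_X_sub_C _]
    simp
  have hz : ∀ g, hh p m (P * g) = 0 := by
    intro g
    rw [hh_apply, mul_comm, map_mul (aeval (Cas p)), mul_assoc, ← F_pow_E_pow p hp, U_Epow]
    simp
  rw [← modByMonic_add_div f P, map_add, hz, add_zero,
    as_sum_range' (f %ₘ P) p ?_, map_sum]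
  · refine N.sum_mem fun k hk => ?_
    rw [← C_mul_X_pow_eq_monomial, ← smul_eq_C_mul, map_smul]
    exact N.smul_mem _ (h k (Finset.mem_range.1 hk))
  · rw [← hdeg]
    apply natDegree_modByMonic_lt _ hm
    intro h1
    rw [h1] at hdeg; simp at hdeg; omega

lemma dd_mem (hp : 2 ≤ p) (m : ℤ) : dd p m ∈ Submodule.span ℂ (Set.range (spanFam p)) := by
  have key : ∀ a : ℕ, 0 < a → a < p →
      dd p (a + 1) ∈ Submodule.span ℂ (Set.range (spanFam p)) := by
    intro a h0 h1
    refine Submodule.subset_span ⟨.inr (.inr ⟨a - 1, by omega⟩), ?_⟩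
    simp only [spanFam]
    congr 1
    omega
  have hpos : (0 : ℤ) < 2 * p := by omega
  have h1 := Int.emod_nonneg (m - 1) hpos.ne'
  have h2 := Int.emod_lt_of_pos (m - 1) hpos
  have h3 : dd p m = dd p ((m - 1) % (2 * p) + 1) := by
    apply dd_congr p hp
    rw [show m - ((m - 1) % (2 * p) + 1) = (m - 1) - (m - 1) % (2 * p) by ring]
    exact Int.dvd_self_sub_emod
  rw [h3]
  generalize (m - 1) % (2 * p) = r at *
  lift r to ℕ using h1
  by_cases hr0 : r = 0
  · rw [add_comm, dd_zero p hp _ (by simp [hr0])]; exact Submodule.zero_mem _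
  by_cases hr1 : r = p
  · rw [add_comm, dd_zero p hp _ (by simp [hr1])]; exact Submodule.zero_mem _
  by_cases hr2 : r < p
  · exact key r (by omega) hr2
  · have : dd p (r + 1) = - dd p (((2 * p - r : ℕ) : ℤ) + 1) := by
      rw [← dd_rel p hp (2 * p - r) (by omega) (by omega)]
      apply dd_congr p hp
      refine ⟨1, ?_⟩
      omega
    rw [this]
    exact Submodule.neg_mem _ (key _ (by omega) (by omega))

lemma hh_mem (hp : 2 ≤ p) (m : ℕ) (f : Polynomial ℂ) :
    hh p m f ∈ Submodule.span ℂ (Set.range (spanFam p)) := by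
  have h0 : hh p 0 f ∈ Submodule.span ℂ (Set.range (spanFam p)) :=
    hh_base p hp 0 (Submodule.span ℂ (Set.range (spanFam p))) (fun k hk => Submodule.subset_span ⟨Sum.inl (⟨k, hk⟩ : Fin p), rfl⟩) f
  have h1 : hh p 1 f ∈ Submodule.span ℂ (Set.range (spanFam p)) :=
    hh_base p hp 1 (Submodule.span ℂ (Set.range (spanFam p))) (fun k hk => Submodule.subset_span ⟨Sum.inr (Sum.inl (⟨k, hk⟩ : Fin p)), rfl⟩) f
  rcases Nat.even_or_odd' m with ⟨n, rfl | rfl⟩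
  · have := hh_sum p hp 0 f n
    rw [show ((2 * n : ℕ) : ℤ) = 0 + 2 * n by push_cast; ring, this]
    exact Submodule.add_mem _ h0 (Submodule.sum_mem _ fun i _ =>
      Submodule.smul_mem _ _ (dd_mem p hp _))
  · have := hh_sum p hp 1 f n
    rw [show ((2 * n + 1 : ℕ) : ℤ) = 1 + 2 * n by push_cast; ring, this]
    exact Submodule.add_mem _ h1 (Submodule.sum_mem _ fun i _ =>
      Submodule.smul_mem _ _ (dd_mem p hp _))

lemma K_Epow (a : ℕ) : UK p * UE p ^ a = ((qq p) ^ 2) ^ a • (UE p ^ a * UK p) := by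
  induction a with
  | zero => simp
  | succ a ih =>
    rw [pow_succ, ← mul_assoc, ih, smul_mul_assoc, mul_assoc, U_KE, mul_smul_comm, smul_smul,
      ← mul_assoc, ← pow_succ]

lemma K_Fpow (a : ℕ) : UK p * UF p ^ a = (((qq p) ^ 2)⁻¹) ^ a • (UF p ^ a * UK p) := by
  induction a with
  | zero => simp
  | succ a ih =>
    rw [pow_succ, ← mul_assoc, ih, smul_mul_assoc, mul_assoc, U_KF, mul_smul_comm, smul_smul,
      ← mul_assoc, ← pow_succ]

/-- triangular spanning space -/
def triS : Submodule ℂ (Uq p) :=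
  Submodule.span ℂ ({x | ∃ a k l : ℕ, x = UE p ^ a * (Cas p ^ k * UK p ^ l)} ∪
    {x | ∃ a k l : ℕ, x = UF p ^ a * (Cas p ^ k * UK p ^ l)})

lemma triS_E (a k l : ℕ) : UE p ^ a * (Cas p ^ k * UK p ^ l) ∈ triS p :=
  Submodule.subset_span (Or.inl ⟨a, k, l, rfl⟩)

lemma triS_F (a k l : ℕ) : UF p ^ a * (Cas p ^ k * UK p ^ l) ∈ triS p :=
  Submodule.subset_span (Or.inr ⟨a, k, l, rfl⟩)

lemma triS_ind (y : Uq p) (hE : ∀ a k l, y * (UE p ^ a * (Cas p ^ k * UK p ^ l)) ∈ triS p)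
    (hF : ∀ a k l, y * (UF p ^ a * (Cas p ^ k * UK p ^ l)) ∈ triS p) :
    ∀ x ∈ triS p, y * x ∈ triS p := by
  intro x hx
  have : triS p ≤ (triS p).comap (LinearMap.mulLeft ℂ y) := by
    conv_lhs => unfold triS
    rw [Submodule.span_le]
    rintro _ (⟨a, k, l, rfl⟩ | ⟨a, k, l, rfl⟩)
    · exact hE a k l
    · exact hF a k l
  exact this hx

lemma triS_K : ∀ x ∈ triS p, UK p * x ∈ triS p := by
  have hc : ∀ k, UK p * Cas p ^ k = Cas p ^ k * UK p := fun k =>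
    ((Commute.pow_left (Cas_K p) k).eq).symm
  apply triS_ind
  · intro a k l
    rw [← mul_assoc, K_Epow, smul_mul_assoc, mul_assoc, ← mul_assoc (UK p), hc, mul_assoc,
      ← pow_succ']
    exact Submodule.smul_mem _ _ (triS_E p _ _ _)
  · intro a k l
    rw [← mul_assoc, K_Fpow, smul_mul_assoc, mul_assoc, ← mul_assoc (UK p), hc, mul_assoc,
      ← pow_succ']
    exact Submodule.smul_mem _ _ (triS_F p _ _ _)

lemma triS_Kinv (hp : 2 ≤ p) : ∀ x ∈ triS p, UKinv p * x ∈ triS p := by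
  have : ∀ n : ℕ, ∀ x ∈ triS p, UK p ^ n * x ∈ triS p := by
    intro n
    induction n with
    | zero => simp
    | succ n ih =>
      intro x hx
      rw [pow_succ, mul_assoc]
      exact ih _ (triS_K p _ hx)
  rw [U_Kinv_eq p hp]
  exact this _

lemma triS_C (hp : 2 ≤ p) : ∀ x ∈ triS p, Cas p * x ∈ triS p := by
  apply triS_ind
  · intro a k l
    rw [← mul_assoc, (Commute.pow_right (Cas_E p hp) a).eq, mul_assoc, ← mul_assoc (Cas p),
      ← pow_succ']
    exact triS_E p _ _ _
  · intro a k l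
    rw [← mul_assoc, (Commute.pow_right (Cas_F p hp) a).eq, mul_assoc, ← mul_assoc (Cas p),
      ← pow_succ']
    exact triS_F p _ _ _

lemma triS_top (hp : 2 ≤ p) : ∀ x, x ∈ triS p := by
  have hEF : ∀ x ∈ triS p, UE p * UF p * x ∈ triS p := by
    intro x hx
    have : UE p * UF p = Cas p -
      ((qq p - (qq p)⁻¹) ^ 2)⁻¹ • ((qq p)⁻¹ • UK p + qq p • UKinv p) := by
      unfold Cas; abel
    rw [this, sub_mul, smul_mul_assoc, add_mul, smul_mul_assoc, smul_mul_assoc]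
    exact Submodule.sub_mem _ (triS_C p hp _ hx) (Submodule.smul_mem _ _
      (Submodule.add_mem _ (Submodule.smul_mem _ _ (triS_K p _ hx))
        (Submodule.smul_mem _ _ (triS_Kinv p hp _ hx))))
  have hFE : ∀ x ∈ triS p, UF p * UE p * x ∈ triS p := by
    intro x hx
    have : UF p * UE p = Cas p -
      ((qq p - (qq p)⁻¹) ^ 2)⁻¹ • (qq p • UK p + (qq p)⁻¹ • UKinv p) := by
      rw [Cas_alt p hp]; abel
    rw [this, sub_mul, smul_mul_assoc, add_mul, smul_mul_assoc, smul_mul_assoc]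
    exact Submodule.sub_mem _ (triS_C p hp _ hx) (Submodule.smul_mem _ _
      (Submodule.add_mem _ (Submodule.smul_mem _ _ (triS_K p _ hx))
        (Submodule.smul_mem _ _ (triS_Kinv p hp _ hx))))
  apply U_top p (triS p)
  · simpa using triS_E p 0 0 0
  · apply triS_ind
    · intro a k l
      rw [← mul_assoc, ← pow_succ']
      exact triS_E p _ _ _
    · intro a k l
      rcases a with _ | a
      · simpa using triS_E p 1 k l
      · rw [pow_succ', mul_assoc (UF p), ← mul_assoc]
        exact hEF _ (triS_F p _ _ _)
  · apply triS_ind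
    · intro a k l
      rcases a with _ | a
      · simpa using triS_F p 1 k l
      · rw [pow_succ', mul_assoc (UE p), ← mul_assoc]
        exact hFE _ (triS_E p _ _ _)
    · intro a k l
      rw [← mul_assoc, ← pow_succ']
      exact triS_F p _ _ _
  · exact triS_K p
  · exact triS_Kinv p hp

lemma weight_mem (x : Uq p) (z : ℂ) (hz : z ≠ 1) (h : UK p * x = z • (x * UK p)) :
    x ∈ commSpan p := by
  have h1 := comm_mem p (UK p) (x * UKinv p)
  rw [← mul_assoc, h, mul_assoc x, U_KinvK, smul_mul_assoc, mul_assoc, U_KKinv, mul_one] at h1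
  have h2 : z • x - x = (z - 1) • x := by
    rw [Algebra.smul_def, Algebra.smul_def, map_sub, sub_mul, map_one, one_mul]
  rw [h2] at h1
  exact (Submodule.smul_mem_iff _ (sub_ne_zero.2 hz)).1 h1

lemma q2_pow_ne (hp : 2 ≤ p) (a : ℕ) (h0 : 0 < a) (h1 : a < p) : ((qq p) ^ 2) ^ a ≠ 1 := by
  rw [← pow_mul]
  exact (qq_prim p hp).pow_ne_one_of_pos_of_lt (by omega) (by omega)

lemma span_top (hp : 2 ≤ p) : ⊤ ≤ Submodule.span ℂ (Set.range (spanFam p)) := by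
  have hc : ∀ k l, UK p * (Cas p ^ k * UK p ^ l) = Cas p ^ k * UK p ^ l * UK p := by
    intro k l
    rw [← mul_assoc, ← (Commute.pow_left (Cas_K p) k).eq, mul_assoc, mul_assoc,
      ← pow_succ', ← pow_succ]
  have h0 : ∀ k l, (commSpan p).mkQ (Cas p ^ k * UK p ^ l) ∈
      Submodule.span ℂ (Set.range (spanFam p)) := by
    intro k l
    rw [K_pow_eq p hp l, Finset.mul_sum, map_sum]
    refine Submodule.sum_mem _ fun m _ => ?_
    rw [mul_smul_comm, map_smul]
    have := hh_mem p hp m (Polynomial.X ^ k)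
    rw [hh_apply] at this
    simp only [map_pow, Polynomial.aeval_X] at this
    exact Submodule.smul_mem _ _ this
  have hz : ∀ x ∈ commSpan p, (commSpan p).mkQ x ∈ Submodule.span ℂ (Set.range (spanFam p)) := by
    intro x hx
    rw [Submodule.mkQ_apply, (Submodule.Quotient.mk_eq_zero _).2 hx]
    exact Submodule.zero_mem _
  have key : triS p ≤ (Submodule.span ℂ (Set.range (spanFam p))).comap (commSpan p).mkQ := by
    unfold triS
    rw [Submodule.span_le]
    rintro _ (⟨a, k, l, rfl⟩ | ⟨a, k, l, rfl⟩)
    · rcases Nat.eq_zero_or_pos a with rfl | ha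
      · simpa using h0 k l
      · apply hz
        rcases lt_or_ge a p with h1 | h1
        · apply weight_mem p _ _ (q2_pow_ne p hp a ha h1)
          rw [← mul_assoc, K_Epow, smul_mul_assoc, mul_assoc, hc, mul_assoc, mul_assoc, mul_assoc]
        · rw [pow_eq_zero_of_le h1 (U_Epow p), zero_mul]
          exact Submodule.zero_mem _
    · rcases Nat.eq_zero_or_pos a with rfl | ha
      · simpa using h0 k l
      · apply hz
        rcases lt_or_ge a p with h1 | h1
        · have hne : (((qq p) ^ 2)⁻¹) ^ a ≠ 1 := by
            rw [inv_pow, Ne, inv_eq_one]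
            exact q2_pow_ne p hp a ha h1
          apply weight_mem p _ _ hne
          rw [← mul_assoc, K_Fpow, smul_mul_assoc, mul_assoc, hc, mul_assoc, mul_assoc, mul_assoc]
        · rw [pow_eq_zero_of_le h1 (U_Fpow p), zero_mul]
          exact Submodule.zero_mem _
  rintro y -
  obtain ⟨x, rfl⟩ := (commSpan p).mkQ_surjective y
  exact key (triS_top p hp x)

lemma hh0_finite (hp : 2 ≤ p) : Module.Finite ℂ (Uq p ⧸ commSpan p) :=
  ⟨(top_le_iff.1 (span_top p hp)) ▸ Submodule.fg_span (Set.finite_range (spanFam p))⟩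

lemma hh0_le (hp : 2 ≤ p) : Module.finrank ℂ (Uq p ⧸ commSpan p) ≤ 3 * p - 1 := by
  have h := finrank_range_le_card (R := ℂ) (spanFam p)
  rw [Set.finrank, top_le_iff.1 (span_top p hp), finrank_top] at h
  refine h.trans ?_
  simp; omega

end upper

end LogHennings

namespace LogHennings

section lower
set_option linter.unusedSectionVars false
variable (p : ℕ) [NeZero p] {R : Type} [CommRing R] [Algebra ℂ R]

lemma prod_range_zmod (e : ZMod p → R) (i : ZMod p) :
    ∏ t ∈ range p, e (i + (t : ℕ)) = ∏ k, e k := by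
  refine Finset.prod_nbij (fun t => i + (t : ℕ)) (by simp) ?_ ?_ (by simp)
  · intro a ha b hb h
    simp only [Finset.coe_range, Set.mem_Iio] at ha hb
    have h' : ((a : ℕ) : ZMod p) = b := add_left_cancel h
    rw [ZMod.natCast_eq_natCast_iff', Nat.mod_eq_of_lt ha, Nat.mod_eq_of_lt hb] at h'
    exact h'
  · intro k _
    refine ⟨(k - i).val, ?_, ?_⟩
    · simpa using ZMod.val_lt (k - i)
    · simp

/-- weights -/
def wt (j : ℤ) (i : ZMod p) : ℤ := j - 2 * (i.val : ℤ)

lemma wt_succ (j : ℤ) (i : ZMod p) : (2 * (p : ℤ)) ∣ wt p j (i + 1) - (wt p j i - 2) := by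
  unfold wt
  have h : (p : ℤ) ∣ ((i.val : ℤ) + 1) - ((i + 1).val : ℤ) := by
    rw [← ZMod.intCast_eq_intCast_iff_dvd_sub]
    push_cast
    simp
  obtain ⟨t, ht⟩ := h
  exact ⟨t, by linear_combination 2 * ht⟩

/-- matrix of E -/
def mE (e : ZMod p → R) : Matrix (ZMod p) (ZMod p) R :=
  Matrix.of fun i k => if k = i + 1 then e i else 0
/-- matrix of F -/
def mF (f : ZMod p → R) : Matrix (ZMod p) (ZMod p) R :=
  Matrix.of fun i k => if i = k + 1 then f k else 0
/-- matrix of K -/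
def mK (R : Type) [CommRing R] [Algebra ℂ R] (j : ℤ) : Matrix (ZMod p) (ZMod p) R :=
  Matrix.diagonal fun i => algebraMap ℂ R ((qq p) ^ (wt p j i))
/-- matrix of the inverse of K -/
def mKi (R : Type) [CommRing R] [Algebra ℂ R] (j : ℤ) : Matrix (ZMod p) (ZMod p) R :=
  Matrix.diagonal fun i => algebraMap ℂ R ((qq p) ^ (-wt p j i))

lemma mE_pow (e : ZMod p → R) (n : ℕ) (i k : ZMod p) :
    (mE p e ^ n) i k = if k = i + (n : ℕ) then ∏ t ∈ range n, e (i + (t : ℕ)) else 0 := by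
  induction n generalizing i with
  | zero => simp [Matrix.one_apply, eq_comm]
  | succ n ih =>
    rw [pow_succ', Matrix.mul_apply, Finset.sum_eq_single (i + 1), ih, Finset.prod_range_succ']
    · have : i + 1 + (n : ZMod p) = i + ((n + 1 : ℕ) : ZMod p) := by push_cast; ring
      rw [this]
      simp only [mE, Matrix.of_apply, if_true]
      split_ifs
      · rw [mul_comm]
        congr 1
        · refine Finset.prod_congr rfl fun t _ => ?_
          congr 1; push_cast; ring
        · simp
      · simp
    · intro b _ hb
      simp [mE, hb]
    · simp

lemma mE_transpose (f : ZMod p → R) : mF p f = (mE p f).transpose := by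
  ext i k; simp [mE, mF]

lemma mE_pow_p (e : ZMod p → R) (he : ∏ k, e k = 0) : mE p e ^ p = 0 := by
  ext i k
  rw [mE_pow, prod_range_zmod, he]; simp

lemma mF_pow_p (e : ZMod p → R) (he : ∏ k, e k = 0) : mF p e ^ p = 0 := by
  rw [mE_transpose, ← Matrix.transpose_pow, mE_pow_p p e he, Matrix.transpose_zero]

lemma mE_mF (e f : ZMod p → R) : mE p e * mF p f = Matrix.diagonal fun i => e i * f i := by
  ext i k
  rw [Matrix.mul_apply, Finset.sum_eq_single (i + 1)]
  · by_cases h : i = k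
    · subst h; simp [mE, mF]
    · simp [mE, mF, h]
  · intro b _ hb; simp [mE, hb]
  · simp

lemma mF_mE (e f : ZMod p → R) :
    mF p f * mE p e = Matrix.diagonal fun i => e (i - 1) * f (i - 1) := by
  ext i k
  rw [Matrix.mul_apply, Finset.sum_eq_single (i - 1)]
  · by_cases h : i = k
    · subst h; simp [mE, mF, mul_comm]
    · simp [mE, mF, h, Ne.symm h]
  · intro b _ hb
    have : i ≠ b + 1 := fun h => hb (by rw [h]; ring)
    simp [mF, this]
  · simp

lemma rep_exists (hp : 2 ≤ p) (j : ℤ) (γ : R) (e f : ZMod p → R)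
    (hef : ∀ i, e i * f i = γ - algebraMap ℂ R (cc p (wt p j i - 1)))
    (he : ∏ k, e k = 0) (hf : ∏ k, f k = 0) :
    ∃ ρ : Uq p →ₐ[ℂ] Matrix (ZMod p) (ZMod p) R,
      ρ (UE p) = mE p e ∧ ρ (UF p) = mF p f ∧ ρ (UK p) = mK p R j ∧ ρ (UKinv p) = mKi p R j := by
  have q0 := qq_ne p
  let g : UGen → Matrix (ZMod p) (ZMod p) R := fun x =>
    match x with
    | UGen.E => mE p e
    | UGen.F => mF p f
    | UGen.K => mK p R j
    | UGen.Kinv => mKi p R j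
  have gE : FreeAlgebra.lift ℂ g fE = mE p e := FreeAlgebra.lift_ι_apply _ _
  have gF : FreeAlgebra.lift ℂ g fF = mF p f := FreeAlgebra.lift_ι_apply _ _
  have gK : FreeAlgebra.lift ℂ g fK = mK p R j := FreeAlgebra.lift_ι_apply _ _
  have gKi : FreeAlgebra.lift ℂ g fKinv = mKi p R j := FreeAlgebra.lift_ι_apply _ _
  have hKKi : mK p R j * mKi p R j = 1 := by
    unfold mK mKi
    rw [Matrix.diagonal_mul_diagonal, ← Matrix.diagonal_one]
    congr 1; funext i
    rw [← map_mul, ← zpow_add₀ q0]; simp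
  have hKiK : mKi p R j * mK p R j = 1 := by
    unfold mK mKi
    rw [Matrix.diagonal_mul_diagonal, ← Matrix.diagonal_one]
    congr 1; funext i
    rw [← map_mul, ← zpow_add₀ q0]; simp
  have hw : ∀ i, (qq p) ^ (wt p j i) * (qq p) ^ (-wt p j (i + 1)) = (qq p) ^ 2 := by
    intro i
    rw [← zpow_add₀ q0, ← zpow_natCast, qz_eq_iff p hp]
    obtain ⟨t, ht⟩ := wt_succ p j i
    exact ⟨-t, by push_cast; linear_combination -ht⟩
  have hrel : ∀ ⦃x y : FU⦄, URel p x y → FreeAlgebra.lift ℂ g x = FreeAlgebra.lift ℂ g y := by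
    intro x y h
    cases h with
    | Epow => rw [map_pow, gE, mE_pow_p p e he, map_zero]
    | Fpow => rw [map_pow, gF, mF_pow_p p f hf, map_zero]
    | Kpow =>
      rw [map_pow, gK, map_one]
      unfold mK
      rw [Matrix.diagonal_pow, ← Matrix.diagonal_one]
      congr 1; funext i
      rw [Pi.pow_apply, ← map_pow, ← zpow_natCast, ← zpow_mul, (qz_one_iff p hp _).2]
      · simp
      · push_cast; exact Dvd.intro_left _ rfl
    | KKinv => rw [map_mul, gK, gKi, hKKi, map_one]
    | KinvK => rw [map_mul, gK, gKi, hKiK, map_one]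
    | KE =>
      rw [map_mul, map_mul, map_smul, gK, gKi, gE]
      ext i k
      unfold mK mKi
      rw [Matrix.mul_diagonal, Matrix.diagonal_mul, Matrix.smul_apply]
      simp only [mE, Matrix.of_apply]
      split_ifs with h
      · subst h
        rw [Algebra.smul_def, ← hw i, map_mul]; ring
      · simp
    | KF =>
      rw [map_mul, map_mul, map_smul, gK, gKi, gF]
      ext i k
      unfold mK mKi
      rw [Matrix.mul_diagonal, Matrix.diagonal_mul, Matrix.smul_apply]
      simp only [mF, Matrix.of_apply]
      split_ifs with h
      · subst h
        rw [Algebra.smul_def, ← hw k, mul_inv, ← zpow_neg, ← zpow_neg, neg_neg, map_mul]; ring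
      · simp
    | EF =>
      rw [map_sub, map_mul, map_mul, map_smul, map_sub, gE, gF, gK, gKi, mE_mF, mF_mE]
      unfold mK mKi
      rw [Matrix.diagonal_sub, Matrix.diagonal_sub, ← Matrix.diagonal_smul]
      congr 1; funext i
      rw [Pi.smul_apply, hef, hef, Algebra.smul_def, ← map_sub, ← map_mul, zpow_neg,
        ← cc_diff p hp, map_sub,
        cc_congr p hp (wt p j (i - 1) - 1) (wt p j i + 1)]
      · ring
      · obtain ⟨t, ht⟩ := wt_succ p j (i - 1)
        rw [sub_add_cancel] at ht
        exact ⟨-t, by linear_combination -ht⟩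
  refine ⟨RingQuot.liftAlgHom ℂ ⟨FreeAlgebra.lift ℂ g, hrel⟩, ?_, ?_, ?_, ?_⟩
  · unfold UE; rw [RingQuot.liftAlgHom_mkAlgHom_apply, gE]
  · unfold UF; rw [RingQuot.liftAlgHom_mkAlgHom_apply, gF]
  · unfold UK; rw [RingQuot.liftAlgHom_mkAlgHom_apply, gK]
  · unfold UKinv; rw [RingQuot.liftAlgHom_mkAlgHom_apply, gKi]

lemma trace_exists (hp : 2 ≤ p) (j : ℤ) (γ : R) (e f : ZMod p → R)
    (hef : ∀ i, e i * f i = γ - algebraMap ℂ R (cc p (wt p j i - 1)))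
    (he : ∏ k, e k = 0) (hf : ∏ k, f k = 0) (w : ZMod p → R)
    (hwe : ∀ i, w i * e i = w (i + 1) * e i) (hwf : ∀ i, w i * f i = w (i + 1) * f i)
    (φ : R →ₗ[ℂ] ℂ) :
    ∃ T : (Uq p ⧸ commSpan p) →ₗ[ℂ] ℂ, ∀ (m : ℤ) (g : Polynomial ℂ),
      T (hh p m g) = ∑ i : ZMod p,
        if (2 * (p : ℤ)) ∣ wt p j i - m then φ (w i * Polynomial.aeval γ g) else 0 := by
  have q0 := qq_ne p
  obtain ⟨ρ, rE, rF, rK, rKi⟩ := rep_exists p hp j γ e f hef he hf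
  set W : Matrix (ZMod p) (ZMod p) R := Matrix.diagonal w with hW
  have hcomm : ∀ x, ρ x * W = W * ρ x := by
    let S : Subalgebra ℂ (Uq p) := (Subalgebra.centralizer ℂ {W}).comap ρ
    have hS : ∀ x, x ∈ S ↔ W * ρ x = ρ x * W := by
      intro x
      simp [S, Subalgebra.mem_centralizer_iff]
    have hE : UE p ∈ S := by
      rw [hS, rE]
      ext i k
      rw [hW, Matrix.diagonal_mul, Matrix.mul_diagonal]
      simp only [mE, Matrix.of_apply]
      split_ifs with h
      · subst h; rw [hwe, mul_comm]
      · simp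
    have hF : UF p ∈ S := by
      rw [hS, rF]
      ext i k
      rw [hW, Matrix.diagonal_mul, Matrix.mul_diagonal]
      simp only [mF, Matrix.of_apply]
      split_ifs with h
      · subst h; rw [← hwf, mul_comm]
      · simp
    have hK : UK p ∈ S := by
      rw [hS, rK, hW, mK, Matrix.diagonal_mul_diagonal, Matrix.diagonal_mul_diagonal]
      congr 1; funext i; rw [mul_comm]
    have hKi : UKinv p ∈ S := by
      rw [hS, rKi, hW, mKi, Matrix.diagonal_mul_diagonal, Matrix.diagonal_mul_diagonal]
      congr 1; funext i; rw [mul_comm]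
    have := U_top p (Subalgebra.toSubmodule S) S.one_mem (fun x hx => S.mul_mem hE hx)
      (fun x hx => S.mul_mem hF hx) (fun x hx => S.mul_mem hK hx) (fun x hx => S.mul_mem hKi hx)
    intro x
    exact ((hS x).1 (this x)).symm
  have hC : ρ (Cas p) = algebraMap R _ γ := by
    unfold Cas
    rw [map_add, map_mul, map_smul, map_add, map_smul, map_smul, rE, rF, rK, rKi, mE_mF]
    unfold mK mKi
    rw [← Matrix.diagonal_smul, ← Matrix.diagonal_smul, Matrix.diagonal_add,
      ← Matrix.diagonal_smul, Matrix.diagonal_add, Matrix.algebraMap_eq_diagonal]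
    congr 1; funext i
    simp only [Pi.smul_apply, hef, Algebra.smul_def, Pi.algebraMap_apply, Algebra.algebraMap_self,
      RingHom.id_apply]
    rw [← map_mul, ← map_mul, ← map_add, ← map_mul]
    have : ((qq p - (qq p)⁻¹) ^ 2)⁻¹ * ((qq p)⁻¹ * qq p ^ wt p j i + qq p * qq p ^ (-wt p j i))
      = cc p (wt p j i - 1) := by
      unfold cc
      rw [neg_sub, sub_eq_add_neg (wt p j i), sub_eq_add_neg 1, zpow_add₀ q0, zpow_add₀ q0,
        zpow_one, zpow_neg_one, div_eq_mul_inv]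
      ring
    rw [this]; ring
  have hI : ∀ m : ℤ, ρ (idm p m) =
      Matrix.diagonal fun i => if (2 * (p : ℤ)) ∣ wt p j i - m then (1 : R) else 0 := by
    intro m
    unfold idm
    rw [map_smul, map_sum]
    simp_rw [map_smul, map_pow, rK, mK, Matrix.diagonal_pow, ← Matrix.diagonal_smul]
    ext i k
    rw [Matrix.smul_apply, Matrix.sum_apply]
    by_cases h : i = k
    · subst h
      simp only [Matrix.diagonal_apply_eq, Pi.smul_apply, Pi.pow_apply]
      simp only [Algebra.smul_def, ← map_pow, ← map_mul, ← map_sum, ← mul_pow, ← zpow_add₀ q0]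
      rw [neg_add_eq_sub, orth p hp]
      split_ifs <;> simp
    · simp [h]
  let T0 : Uq p →ₗ[ℂ] ℂ := φ ∘ₗ (Matrix.traceLinearMap (ZMod p) ℂ R) ∘ₗ
    (LinearMap.mulLeft ℂ W) ∘ₗ ρ.toLinearMap
  have hT0 : ∀ x, T0 x = φ (Matrix.trace (W * ρ x)) := fun x => rfl
  have hker : commSpan p ≤ LinearMap.ker T0 := by
    unfold commSpan
    rw [Submodule.span_le]
    rintro _ ⟨x, y, rfl⟩
    rw [SetLike.mem_coe, LinearMap.mem_ker, map_sub, sub_eq_zero, hT0, hT0, map_mul, map_mul,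
      ← mul_assoc, Matrix.trace_mul_comm, ← mul_assoc, ← mul_assoc, hcomm]
  refine ⟨(commSpan p).liftQ T0 hker, fun m g => ?_⟩
  rw [hh_apply, Submodule.mkQ_apply, Submodule.liftQ_apply, hT0, map_mul, hI,
    ← Polynomial.aeval_algHom_apply, hC, Polynomial.aeval_algebraMap_apply,
    Matrix.algebraMap_eq_diagonal, hW, Matrix.diagonal_mul_diagonal,
    Matrix.diagonal_mul_diagonal, Matrix.trace_diagonal, map_sum]
  refine Finset.sum_congr rfl fun i _ => ?_
  simp only [Pi.algebraMap_apply, Algebra.algebraMap_self, RingHom.id_apply]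
  split_ifs <;> simp

end lower

end LogHennings

namespace LogHennings

section final
set_option linter.unusedSectionVars false
variable (p : ℕ) [NeZero p]

lemma zmod_val_succ (i : ZMod p) (h : i.val + 1 < p) : (i + 1).val = i.val + 1 := by
  have : i + 1 = ((i.val + 1 : ℕ) : ZMod p) := by push_cast; simp
  rw [this, ZMod.val_natCast_of_lt h]

lemma link_last (hp : 2 ≤ p) (j : ℤ) (i : ZMod p) (h : i.val = p - 1) :
    cc p (wt p j i - 1) = cc p (j + 1) := by
  apply cc_congr p hp
  refine ⟨-1, ?_⟩
  unfold wt
  omega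

lemma link_mid (hp : 2 ≤ p) (j : ℕ) (i : ZMod p) (h : i.val = j % p) :
    cc p (wt p j i - 1) = cc p (j + 1) := by
  rw [cc_eq_iff p hp]
  right
  unfold wt
  rw [h]
  have := Nat.div_add_mod j p
  refine ⟨(j / p : ℕ), ?_⟩
  zify at this
  push_cast
  linear_combination (-2) * this

lemma chi_exists (hp : 2 ≤ p) (j : ℕ) :
    ∃ T : (Uq p ⧸ commSpan p) →ₗ[ℂ] ℂ, ∀ (m : ℤ) (g : Polynomial ℂ),
      T (hh p m g) = ∑ i : ZMod p,
        if (2 * (p : ℤ)) ∣ wt p j i - m then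
          (if i.val ≤ j % p then 1 else 0) * g.eval (cc p (j + 1)) else 0 := by
  classical
  have hlast : ((p - 1 : ℕ) : ZMod p).val = p - 1 := ZMod.val_natCast_of_lt (by omega)
  have hll := link_last p hp j _ hlast
  have hw : ∀ i : ZMod p, cc p (wt p j i - 1) ≠ cc p (j + 1) →
      (if i.val ≤ j % p then (1 : ℂ) else 0) = if (i + 1).val ≤ j % p then 1 else 0 := by
    intro i hi
    have h1 : i.val ≠ p - 1 := fun h => hi (link_last p hp j i h)
    have h2 : i.val ≠ j % p := fun h => hi (link_mid p hp j i h)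
    have h3 := ZMod.val_lt i
    rw [zmod_val_succ p i (by omega)]
    congr 1
    rw [eq_iff_iff]; omega
  obtain ⟨T, hT⟩ := trace_exists p hp (R := ℂ) j (cc p (j + 1))
    (fun i => cc p (j + 1) - cc p (wt p j i - 1))
    (fun i => if cc p (wt p j i - 1) = cc p (j + 1) then 0 else 1)
    (by
      intro i
      split_ifs with h
      · simp [h]
      · simp)
    (Finset.prod_eq_zero (Finset.mem_univ _) (by rw [hll, sub_self]))
    (Finset.prod_eq_zero (Finset.mem_univ _) (by rw [if_pos hll]))
    (fun i => if i.val ≤ j % p then 1 else 0)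
    (by
      intro i
      by_cases h : cc p (wt p j i - 1) = cc p (j + 1)
      · simp [h]
      · rw [hw i h])
    (by
      intro i
      by_cases h : cc p (wt p j i - 1) = cc p (j + 1)
      · simp [h]
      · rw [hw i h])
    LinearMap.id
  refine ⟨T, fun m g => ?_⟩
  rw [hT]
  simp [Polynomial.coe_aeval_eq_eval]

/-- four-dimensional coefficient ring -/
abbrev RR := DualNumber (DualNumber ℂ)

/-- first nilpotent -/
def sg : RR := TrivSqZeroExt.inl DualNumber.eps
/-- second nilpotent -/
def ta : RR := DualNumber.eps

lemma sg_sq : sg * sg = 0 := by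
  unfold sg
  rw [← TrivSqZeroExt.inl_mul, DualNumber.eps_mul_eps, TrivSqZeroExt.inl_zero]

lemma ta_sq : ta * ta = 0 := DualNumber.eps_mul_eps

/-- top coefficient -/
def phi : RR →ₗ[ℂ] ℂ where
  toFun x := x.snd.snd
  map_add' _ _ := rfl
  map_smul' _ _ := rfl

lemma phi_top : phi (sg * ta) = 1 := by
  show TrivSqZeroExt.snd (TrivSqZeroExt.snd (sg * ta)) = _
  simp [sg, ta]

lemma phi_alg (z : ℂ) : phi (algebraMap ℂ RR z) = 0 := by
  show TrivSqZeroExt.snd (TrivSqZeroExt.snd (algebraMap ℂ RR z)) = _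
  simp [TrivSqZeroExt.algebraMap_eq_inl']

lemma psi_exists_aux {R : Type} [CommRing R] [Algebra ℂ R] (sg ta : R)
    (sg_sq : sg * sg = 0) (ta_sq : ta * ta = 0) (phi : R →ₗ[ℂ] ℂ)
    (phi_top : phi (sg * ta) = 1) (phi_alg : ∀ z, phi (algebraMap ℂ R z) = 0) (hp : 2 ≤ p) (a : ℕ) (h0 : 0 < a) (h1 : a < p) :
    ∃ T : (Uq p ⧸ commSpan p) →ₗ[ℂ] ℂ, ∀ (m : ℤ) (g : Polynomial ℂ),
      T (hh p m g) = ∑ i : ZMod p,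
        if (2 * (p : ℤ)) ∣ wt p ((a - 1 : ℕ) : ℤ) i - m then
          g.derivative.eval (cc p a) else 0 := by
  classical
  have hja : (((a - 1 : ℕ) : ℤ) + 1) = a := by omega
  generalize hj : a - 1 = j at *
  have hlast : ((p - 1 : ℕ) : ZMod p).val = p - 1 := ZMod.val_natCast_of_lt (by omega)
  have hll := link_last p hp j _ hlast
  have hmid : ((j : ℕ) : ZMod p).val = j := ZMod.val_natCast_of_lt (by omega)
  have hlm := link_mid p hp j _ (hmid.trans (Nat.mod_eq_of_lt (by omega)).symm)
  have hne : ((p - 1 : ℕ) : ZMod p) ≠ ((j : ℕ) : ZMod p) := by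
    intro h
    have := congrArg ZMod.val h
    omega
  rw [hja] at hll hlm
  have hprod : ∀ u : ZMod p → R, u ((p - 1 : ℕ) : ZMod p) * u ((j : ℕ) : ZMod p) = 0 →
      ∏ k, u k = 0 := by
    intro u hu
    rw [← Finset.mul_prod_erase Finset.univ u (Finset.mem_univ ((p - 1 : ℕ) : ZMod p)),
      ← Finset.mul_prod_erase _ u (Finset.mem_erase.2 ⟨hne.symm, Finset.mem_univ (j : ZMod p)⟩),
      ← mul_assoc, hu, zero_mul]
  obtain ⟨T, hT⟩ := trace_exists p hp (R := R) j (algebraMap ℂ R (cc p a) + sg * ta)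
    (fun i => if cc p (wt p j i - 1) = cc p a then sg else
      algebraMap ℂ R (cc p a) + sg * ta - algebraMap ℂ R (cc p (wt p j i - 1)))
    (fun i => if cc p (wt p j i - 1) = cc p a then ta else 1)
    (by
      intro i
      split_ifs with h
      · rw [h]; ring
      · rw [mul_one])
    (hprod _ (by simp only [if_pos hll, if_pos hlm]; exact sg_sq))
    (hprod _ (by simp only [if_pos hll, if_pos hlm]; exact ta_sq))
    (fun _ => 1) (fun _ => rfl) (fun _ => rfl) phi
  refine ⟨T, fun m g => ?_⟩
  rw [hT]
  have hs : (sg * ta) ^ 2 = 0 := by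
    rw [pow_two, mul_mul_mul_comm, sg_sq, zero_mul]
  have : phi (1 * Polynomial.aeval (algebraMap ℂ R (cc p a) + sg * ta) g) =
      g.derivative.eval (cc p a) := by
    rw [one_mul, Polynomial.aeval_add_of_sq_eq_zero _ _ _ hs,
      Polynomial.aeval_algebraMap_apply, Polynomial.aeval_algebraMap_apply, map_add, phi_alg,
      ← Algebra.smul_def, map_smul, phi_top]
    simp [Polynomial.coe_aeval_eq_eval]
  simp_rw [this]

lemma psi_exists (hp : 2 ≤ p) (a : ℕ) (h0 : 0 < a) (h1 : a < p) :
    ∃ T : (Uq p ⧸ commSpan p) →ₗ[ℂ] ℂ, ∀ (m : ℤ) (g : Polynomial ℂ),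
      T (hh p m g) = ∑ i : ZMod p,
        if (2 * (p : ℤ)) ∣ wt p ((a - 1 : ℕ) : ℤ) i - m then
          g.derivative.eval (cc p a) else 0 :=
  psi_exists_aux p (R := RR) sg ta sg_sq ta_sq phi phi_top phi_alg hp a h0 h1

lemma hh0_ge (hp : 2 ≤ p) : 3 * p - 1 ≤ Module.finrank ℂ (Uq p ⧸ commSpan p) := by
  have := hh0_finite p hp
  choose χ hχ using chi_exists p hp
  have hψ' : ∀ a : Fin (p - 1), ∃ T : (Uq p ⧸ commSpan p) →ₗ[ℂ] ℂ, ∀ (m : ℤ) (g : Polynomial ℂ),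
      T (hh p m g) = ∑ i : ZMod p,
        if (2 * (p : ℤ)) ∣ wt p (a : ℕ) i - m then
          g.derivative.eval (cc p ((a : ℕ) + 1 : ℕ)) else 0 := by
    intro a
    have := psi_exists p hp (a + 1) (by omega) (by omega)
    simpa using this
  choose ψ hψ using hψ'
  have hcca : ∀ a b : Fin (p - 1),
      cc p (((b : ℕ) + 1 : ℕ) : ℤ) = cc p (((a : ℕ) + 1 : ℕ) : ℤ) → b = a := by
    intro a b h
    have ha := a.2
    have hb := b.2
    rw [cc_eq_iff p hp] at h
    rcases h with h | h
    · have := Int.eq_zero_of_abs_lt_dvd h (by rw [abs_lt]; omega)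
      apply Fin.ext; omega
    · have := Int.eq_zero_of_abs_lt_dvd h (by rw [abs_lt]; omega)
      omega
  have hdvd0 : ∀ (j : ℤ) (i : ZMod p), (2 * (p : ℤ)) ∣ wt p j i - j ↔ i = 0 := by
    intro j i
    constructor
    · intro h
      have hi := ZMod.val_lt i
      have h2 : wt p j i - j = -2 * i.val := by unfold wt; ring
      rw [h2] at h
      have := Int.eq_zero_of_abs_lt_dvd h (by rw [abs_lt]; omega)
      rw [← ZMod.val_eq_zero]; omega
    · rintro rfl; simp [wt]
  have hli : LinearIndependent ℂ
      (Sum.elim (fun j : Fin (2 * p) => χ j) ψ :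
        Fin (2 * p) ⊕ Fin (p - 1) → Module.Dual ℂ (Uq p ⧸ commSpan p)) := by
    rw [Fintype.linearIndependent_iff]
    intro c hc
    rw [Fintype.sum_sum_type] at hc
    simp only [Sum.elim_inl, Sum.elim_inr] at hc
    have hev : ∀ (m : ℤ) (g : Polynomial ℂ),
        ∑ j : Fin (2 * p), c (.inl j) * χ j (hh p m g) +
        ∑ a : Fin (p - 1), c (.inr a) * ψ a (hh p m g) = 0 := by
      intro m g
      have := LinearMap.congr_fun hc (hh p m g)
      simpa [LinearMap.sum_apply] using this
    have hγ : ∀ a : Fin (p - 1), c (.inr a) = 0 := by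
      intro a
      set x := cc p (((a : ℕ) + 1 : ℕ) : ℤ) with hx
      have h := hev (a : ℕ) ((Polynomial.X - Polynomial.C x) * gp p x ^ 2)
      have h1 : ∀ n : ℤ, ((Polynomial.X - Polynomial.C x) * gp p x ^ 2).eval (cc p n) = 0 := by
        intro n
        by_cases hn : cc p n = x
        · simp [hn]
        · simp [gp_other p hp x n hn]
      rw [Finset.sum_eq_zero, zero_add, Finset.sum_eq_single a, hψ, Finset.sum_eq_single 0] at h
      · rw [if_pos ((hdvd0 _ _).2 rfl), ← hx, mul_eq_zero] at h
        refine h.resolve_right ?_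
        simp [Polynomial.derivative_mul, gp_self p x]
      · intro i _ hi
        rw [if_neg (fun h => hi ((hdvd0 _ _).1 h))]
      · simp
      · intro b _ hb
        have hn : cc p (((b : ℕ) + 1 : ℕ) : ℤ) ≠ x := fun h => hb (hcca a b h)
        rw [hψ, Finset.sum_eq_zero, mul_zero]
        intro i _
        have hg := gp_other p hp x _ hn
        generalize cc p (((b : ℕ) + 1 : ℕ) : ℤ) = y at hg ⊢
        split_ifs
        · simp [Polynomial.derivative_mul, Polynomial.derivative_pow, hg]
        · rfl
      · simp
      · intro j _
        rw [hχ, Finset.sum_eq_zero, mul_zero]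
        intro i _
        rw [h1]; simp
    have hα : ∀ j : Fin (2 * p), c (.inl j) = 0 := by
      intro j
      set x := cc p ((j : ℕ) + 1) with hx
      have h := hev (j : ℕ) (gp p x)
      simp only [hγ, zero_mul, Finset.sum_const_zero, add_zero] at h
      rw [Finset.sum_eq_single j, hχ, Finset.sum_eq_single 0] at h
      · rw [if_pos ((hdvd0 _ _).2 rfl), ← hx, mul_eq_zero] at h
        refine h.resolve_right ?_
        simp [gp_self p x]
      · intro i _ hi
        rw [if_neg (fun h => hi ((hdvd0 _ _).1 h))]
      · simp
      · intro k _ hk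
        rw [hχ, Finset.sum_eq_zero, mul_zero]
        intro i _
        by_cases hn : cc p ((k : ℕ) + 1) = x
        · rw [hx, cc_eq_iff p hp] at hn
          have hj2 := j.2
          have hk2 := k.2
          have hkj : (k : ℕ) ≠ j := fun h => hk (Fin.ext h)
          have hi := ZMod.val_lt i
          have hsum : (k : ℕ) + j + 2 = 2 * p := by
            rcases hn with h | h
            · have := Int.eq_zero_of_abs_lt_dvd h (by rw [abs_lt]; omega)
              omega
            · have h' : (2 * (p : ℤ)) ∣ ((k : ℕ) : ℤ) + 1 + (((j : ℕ) : ℤ) + 1) - 2 * p :=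
                dvd_sub_self_right.2 h
              have := Int.eq_zero_of_abs_lt_dvd h' (by rw [abs_lt]; omega)
              omega
          split_ifs with h1 h2
          · exfalso
            unfold wt at h1
            obtain ⟨t, ht⟩ := h1
            have ht2 : (p : ℤ) - 1 - (j : ℕ) - i.val = p * t := by
              have : ((k : ℕ) : ℤ) = 2 * p - 2 - (j : ℕ) := by omega
              rw [this] at ht
              linarith
            rcases lt_or_ge (k : ℕ) p with hkp | hkp
            · rw [Nat.mod_eq_of_lt hkp] at h2
              have hd : (p : ℤ) ∣ (p : ℤ) - 1 - (j : ℕ) - i.val + p :=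
                Dvd.dvd.add ⟨t, ht2⟩ dvd_rfl
              have := Int.eq_zero_of_abs_lt_dvd hd (by rw [abs_lt]; omega)
              omega
            · rw [Nat.mod_eq_sub_mod hkp, Nat.mod_eq_of_lt (by omega)] at h2
              have hd : (p : ℤ) ∣ (p : ℤ) - 1 - (j : ℕ) - i.val := ⟨t, ht2⟩
              have := Int.eq_zero_of_abs_lt_dvd hd (by rw [abs_lt]; omega)
              omega
          · simp
          · rfl
        · rw [gp_other p hp x _ hn]; simp
      · simp
    rintro (j | a)
    · exact hα j
    · exact hγ a
  have h := hli.fintype_card_le_finrank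
  rw [Subspace.dual_finrank_eq] at h
  refine le_trans ?_ h
  simp; omega

end final

end LogHennings

open LogHennings in
/-- The zeroth Hochschild homology `HH₀(U) = U/[U,U]` has dimension `3p - 1`. -/
theorem hh0_dimension (p : ℕ) (hp : 2 ≤ p) :
    Module.finrank ℂ (Uq p ⧸ commSpan p) = 3 * p - 1 := by
  have : NeZero p := ⟨by omega⟩
  exact le_antisymm (hh0_le p hp) (hh0_ge p hp)
end
end
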